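/- arXiv:1203.4956 — 2 statements merged into one kernel-verified Lean document; each statement's English description precedes it below -/
import Mathlib

section
/- Every von Neumann algebra M that is n-subhomogeneous as a C*-algebra is *-isomorphic to a finite product ∏_{k≤n} M_k(B_k) where each B_k is an abelian von Neumann algebra. -/
noncomputable section

/-- A (nondegenerate, topologically) irreducible representation of a `*`-algebra `A` on a
complex Hilbert space `H`: some operator in the image is nonzero, and the only closed
invariant subspaces are `⊥` and `⊤`. -/
def IsIrreducibleRep {A : Type*} [NonUnitalNonAssocSemiring A] [DistribMulAction ℂ A] [Star A]
    {H : Type*} [NormedAddCommGroup H] [InnerProductSpace ℂ H] [CompleteSpace H]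
    (π : A →⋆ₙₐ[ℂ] (H →L[ℂ] H)) : Prop :=
  (∃ a, π a ≠ 0) ∧
    ∀ S : Submodule ℂ H, IsClosed (S : Set H) →
      (∀ a : A, ∀ v ∈ S, π a v ∈ S) → S = ⊥ ∨ S = ⊤

/-- A `*`-algebra is `n`-subhomogeneous if all its irreducible representations (on complex
Hilbert spaces) have dimension at most `n`. -/
def IsSubhomogeneous (n : ℕ) (A : Type*) [NonUnitalNonAssocSemiring A]
    [DistribMulAction ℂ A] [Star A] : Prop :=
  ∀ (H : Type) [NormedAddCommGroup H] [InnerProductSpace ℂ H] [CompleteSpace H]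
    (π : A →⋆ₙₐ[ℂ] (H →L[ℂ] H)), IsIrreducibleRep π → Module.rank ℂ H ≤ n

set_option synthInstance.maxHeartbeats 1000000
set_option maxHeartbeats 1000000

/-- A decomposition of a `*`-algebra `M` as a finite product `∏_{k ≤ n} M_k(B_k)` with
each `B_k` an abelian von Neumann algebra. -/
structure SubhomVNDecomposition (n : ℕ) (M : Type*) [Ring M] [StarRing M] [Algebra ℂ M] where
  K : Fin n → Type
  [instK : ∀ k, NormedAddCommGroup (K k)]
  [instK2 : ∀ k, InnerProductSpace ℂ (K k)]
  [instK3 : ∀ k, CompleteSpace (K k)]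
  B : ∀ k, VonNeumannAlgebra (K k)
  comm : ∀ k, ∀ x y : (B k).toStarSubalgebra, x * y = y * x
  iso : M ≃⋆ₐ[ℂ]
    (∀ k : Fin n, Matrix (Fin (k.1 + 1)) (Fin (k.1 + 1)) ((B k).toStarSubalgebra))

section PureStates

open scoped ComplexOrder InnerProductSpace

variable {A : Type*} [CStarAlgebra A]

/-- The states of a C*-algebra that take the value `1` at `e`, as a set of functions. -/
def statesAt (e : A) : Set (A → ℂ) :=
  {φ | (∀ a b, φ (a + b) = φ a + φ b) ∧ (∀ (c : ℂ) a, φ (c • a) = c * φ a) ∧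
    (∀ a, 0 ≤ φ (star a * a)) ∧ φ 1 = 1 ∧ φ e = 1 ∧ ∀ a, ‖φ a‖ ≤ ‖a‖}

lemma isCompact_statesAt (e : A) : IsCompact (statesAt e) := by
  have hK : IsCompact (Set.univ.pi fun a : A => Metric.closedBall (0 : ℂ) ‖a‖) :=
    isCompact_univ_pi fun a => isCompact_closedBall _ _
  refine hK.of_isClosed_subset ?_ fun φ hφ a _ => by simpa using hφ.2.2.2.2.2 a
  simp only [statesAt, Set.ofPred_and, Set.ofPred_forall]
  refine IsClosed.inter ?_ (IsClosed.inter ?_ (IsClosed.inter ?_ (IsClosed.inter ?_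
    (IsClosed.inter ?_ ?_))))
  · exact isClosed_iInter fun a => isClosed_iInter fun b =>
      isClosed_eq (by fun_prop) (by fun_prop)
  · exact isClosed_iInter fun a => isClosed_iInter fun b =>
      isClosed_eq (by fun_prop) (by fun_prop)
  · exact isClosed_iInter fun a => isClosed_le (by fun_prop) (by fun_prop)
  · exact isClosed_eq (by fun_prop) (by fun_prop)
  · exact isClosed_eq (by fun_prop) (by fun_prop)
  · exact isClosed_iInter fun a => isClosed_le (by fun_prop) (by fun_prop)

variable {H : Type*} [NormedAddCommGroup H] [InnerProductSpace ℂ H] [CompleteSpace H]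

lemma inner_star_mul_self (π : A →⋆ₙₐ[ℂ] (H →L[ℂ] H)) (v : H) (a : A) :
    ⟪v, π (star a * a) v⟫_ℂ = ((‖π a v‖ ^ 2 : ℝ) : ℂ) := by
  rw [map_mul, map_star, mul_apply_eq_comp, ContinuousLinearMap.star_eq_adjoint,
    ContinuousLinearMap.adjoint_inner_right, inner_self_eq_norm_sq_to_K]
  simp

lemma starProjection_apply_comm_of_invariant (π : A →⋆ₙₐ[ℂ] (H →L[ℂ] H)) (K : Submodule ℂ H)
    [K.HasOrthogonalProjection] (hK : ∀ a, ∀ v ∈ K, π a v ∈ K) (a : A) (v : H) :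
    K.starProjection (π a v) = π a (K.starProjection v) := by
  refine Submodule.eq_starProjection_of_mem_of_inner_eq_zero
    (hK _ _ (K.starProjection_apply_mem v)) fun w hw => ?_
  rw [← map_sub, ← ContinuousLinearMap.adjoint_inner_right, ← ContinuousLinearMap.star_eq_adjoint,
    ← map_star]
  exact Submodule.starProjection_inner_eq_zero _ _ (hK _ _ hw)

variable [PartialOrder A] [StarOrderedRing A]

/-- The positive linear functional underlying an element of `statesAt e`. -/
def positiveOfStatesAt {e : A} {φ : A → ℂ} (hφ : φ ∈ statesAt e) : A →ₚ[ℂ] ℂ :=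
  PositiveLinearMap.mk₀ { toFun := φ, map_add' := hφ.1, map_smul' := hφ.2.1 } (by
    intro x hx
    obtain ⟨b, rfl⟩ := CStarAlgebra.nonneg_iff_eq_star_mul_self.1 hx
    exact hφ.2.2.1 b)

@[simp]
lemma positiveOfStatesAt_apply {e : A} {φ : A → ℂ} (hφ : φ ∈ statesAt e) (a : A) :
    positiveOfStatesAt hφ a = φ a := rfl

lemma inner_nonneg_of_nonneg (π : A →⋆ₙₐ[ℂ] (H →L[ℂ] H)) (v : H) {a : A} (ha : 0 ≤ a) :
    0 ≤ ⟪v, π a v⟫_ℂ := by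
  obtain ⟨b, rfl⟩ := CStarAlgebra.nonneg_iff_eq_star_mul_self.1 ha
  rw [inner_star_mul_self]
  exact Complex.zero_le_real.2 (sq_nonneg _)

/-- Normalized vector functionals of a representation are states. -/
lemma vectorState_mem (π : A →⋆ₙₐ[ℂ] (H →L[ℂ] H)) (h1 : π 1 = 1) {v : H} (hv : v ≠ 0) {e : A}
    (he : ⟪v, π e v⟫_ℂ = ((‖v‖ ^ 2 : ℝ) : ℂ)) :
    (fun a => ((‖v‖ ^ 2 : ℝ) : ℂ)⁻¹ * ⟪v, π a v⟫_ℂ) ∈ statesAt e := by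
  have hn : ((‖v‖ ^ 2 : ℝ) : ℂ) ≠ 0 := by
    exact_mod_cast (pow_ne_zero 2 (norm_ne_zero_iff.2 hv))
  refine ⟨fun a b => ?_, fun c a => ?_, fun a => ?_, ?_, ?_, fun a => ?_⟩
  · simp only [map_add, add_apply, inner_add_right, mul_add]
  · simp only [map_smul, smul_apply, inner_smul_right]
    ring
  · refine mul_nonneg ?_ (inner_nonneg_of_nonneg π v (star_mul_self_nonneg a))
    rw [← Complex.ofReal_inv]
    exact_mod_cast inv_nonneg.2 (sq_nonneg ‖v‖)
  · simp only [h1, one_apply_eq_self, inner_self_eq_norm_sq_to_K]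
    push_cast at hn ⊢
    exact inv_mul_cancel₀ hn
  · simp only [he, inv_mul_cancel₀ hn]
  · have hv' : 0 < ‖v‖ ^ 2 := pow_pos (norm_pos_iff.2 hv) 2
    rw [norm_mul, norm_inv, Complex.norm_real, Real.norm_of_nonneg hv'.le,
      inv_mul_le_iff₀ hv']
    calc ‖⟪v, π a v⟫_ℂ‖ ≤ ‖v‖ * ‖π a v‖ := norm_inner_le_norm _ _
      _ ≤ ‖v‖ * (‖a‖ * ‖v‖) := by
        gcongr
        exact (π a).le_of_opNorm_le (NonUnitalStarAlgHom.norm_apply_le π a) v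
      _ = ‖v‖ ^ 2 * ‖a‖ := by ring

/-- A cyclic representation whose vector state is extreme is irreducible. -/
lemma isIrreducibleRep_of_extreme (π : A →⋆ₙₐ[ℂ] (H →L[ℂ] H)) (h1 : π 1 = 1) {e : A}
    (he1 : e ≤ 1) {ξ : H} (hξ : ‖ξ‖ = 1)
    (hcyc : Dense (Set.range fun a => π a ξ))
    (hext : (fun a => ⟪ξ, π a ξ⟫_ℂ) ∈ Set.extremePoints ℝ (statesAt e)) :
    IsIrreducibleRep π := by
  refine ⟨⟨1, fun h => ?_⟩, fun K hKc hK => ?_⟩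
  · rw [h1] at h
    have : ξ = 0 := by simpa using congrArg (fun T : H →L[ℂ] H => T ξ) h
    simp [this] at hξ
  have : CompleteSpace K := hKc.completeSpace_coe
  set P := K.starProjection with hP
  have hcomm : ∀ a v, P (π a v) = π a (P v) := starProjection_apply_comm_of_invariant π K hK
  set η := P ξ with hη
  set ζ := ξ - η with hζ
  have hηK : η ∈ K := K.starProjection_apply_mem ξ
  have horth : ∀ w ∈ K, ⟪ζ, w⟫_ℂ = 0 := fun w hw => Submodule.starProjection_inner_eq_zero _ _ hw
  have hsum : ∀ a, ⟪ξ, π a ξ⟫_ℂ = ⟪η, π a η⟫_ℂ + ⟪ζ, π a ζ⟫_ℂ := by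
    intro a
    have e1 : ⟪ζ, π a η⟫_ℂ = 0 := horth _ (hK _ _ hηK)
    have e2 : ⟪η, π a ζ⟫_ℂ = 0 := by
      rw [← ContinuousLinearMap.adjoint_inner_left, ← ContinuousLinearMap.star_eq_adjoint,
        ← map_star]
      exact inner_eq_zero_symm.1 (horth _ (hK _ _ hηK))
    have : ξ = η + ζ := by simp [hζ]
    conv_lhs => rw [this]
    rw [map_add, inner_add_left, inner_add_right, inner_add_right, e1, e2]
    ring
  have hden : ∀ S T : H →L[ℂ] H, (∀ a, S (π a ξ) = T (π a ξ)) → S = T := by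
    intro S T h
    refine DFunLike.coe_injective (Continuous.ext_on hcyc S.continuous T.continuous ?_)
    rintro _ ⟨a, rfl⟩
    exact h a
  by_cases hη0 : η = 0
  · left
    have : P = 0 := hden _ _ fun a => by rw [hcomm, ← hη, hη0]; simp
    rw [eq_bot_iff]
    intro w hw
    have h2 : P w = w := Submodule.starProjection_eq_self_iff.2 hw
    rw [this] at h2
    exact h2.symm
  by_cases hζ0 : ζ = 0
  · right
    have hηξ : P ξ = ξ := (sub_eq_zero.1 hζ0).symm
    have : P = 1 := hden _ _ fun a => by rw [hcomm, hηξ]; simp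
    rw [eq_top_iff]
    intro w _
    have : P w = w := by rw [this]; rfl
    exact Submodule.starProjection_eq_self_iff.1 this
  exfalso
  have hn : ‖η‖ ^ 2 + ‖ζ‖ ^ 2 = 1 := by
    have := hsum 1
    simp only [h1, one_apply_eq_self, inner_self_eq_norm_sq_to_K, hξ] at this
    norm_cast at this
    rw [← this]; simp
  have hle : ∀ v : H, ⟪v, π e v⟫_ℂ ≤ ((‖v‖ ^ 2 : ℝ) : ℂ) := by
    intro v
    have := inner_nonneg_of_nonneg π v (sub_nonneg.2 he1)
    rw [map_sub, h1, sub_apply, inner_sub_right, sub_nonneg,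
      one_apply_eq_self, inner_self_eq_norm_sq_to_K] at this
    simpa using this
  have hee : ⟪ξ, π e ξ⟫_ℂ = 1 := hext.1.2.2.2.2.1
  rw [hsum] at hee
  have hsum1 : ((‖η‖ ^ 2 : ℝ) : ℂ) + ((‖ζ‖ ^ 2 : ℝ) : ℂ) = 1 := by exact_mod_cast hn
  have heη : ⟪η, π e η⟫_ℂ = ((‖η‖ ^ 2 : ℝ) : ℂ) := by
    refine le_antisymm (hle η) ?_
    have h2 := hle ζ
    rw [eq_sub_of_add_eq' hee, eq_sub_of_add_eq' hsum1] at h2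
    linear_combination h2
  have heζ : ⟪ζ, π e ζ⟫_ℂ = ((‖ζ‖ ^ 2 : ℝ) : ℂ) := by
    rw [eq_sub_of_add_eq' hee, eq_sub_of_add_eq' hsum1, heη]
  have hηp : 0 < ‖η‖ ^ 2 := pow_pos (norm_pos_iff.2 hη0) 2
  have hζp : 0 < ‖ζ‖ ^ 2 := pow_pos (norm_pos_iff.2 hζ0) 2
  have key := (mem_extremePoints_iff_left.1 hext).2 _ (vectorState_mem π h1 hη0 heη) _
    (vectorState_mem π h1 hζ0 heζ) ⟨‖η‖ ^ 2, ‖ζ‖ ^ 2, hηp, hζp, hn, by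
      funext a
      have c1 : ((‖η‖ ^ 2 : ℝ) : ℂ) ≠ 0 := by exact_mod_cast hηp.ne'
      have c2 : ((‖ζ‖ ^ 2 : ℝ) : ℂ) ≠ 0 := by exact_mod_cast hζp.ne'
      simp only [Pi.add_apply, Pi.smul_apply, Complex.real_smul]
      rw [mul_inv_cancel_left₀ c1, mul_inv_cancel_left₀ c2, hsum]⟩
  have c1 : ((‖η‖ ^ 2 : ℝ) : ℂ) ≠ 0 := by exact_mod_cast hηp.ne'
  have key2 : ∀ a, ⟪η - ((‖η‖ ^ 2 : ℝ) : ℂ) • ξ, π a ξ⟫_ℂ = 0 := by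
    intro a
    have : ((‖η‖ ^ 2 : ℝ) : ℂ)⁻¹ * ⟪η, π a η⟫_ℂ = ⟪ξ, π a ξ⟫_ℂ := congrFun key a
    rw [inv_mul_eq_iff_eq_mul₀ c1] at this
    have e1 : ⟪η, π a η⟫_ℂ = ⟪η, π a ξ⟫_ℂ := by
      rw [hη, ← hcomm, ← Submodule.inner_starProjection_left_eq_right]
      rw [← hP, ← hη, hP, Submodule.starProjection_eq_self_iff.2 hηK]
    rw [inner_sub_left, inner_smul_left, Complex.conj_ofReal, ← e1, this, sub_self]
  have key3 : η - ((‖η‖ ^ 2 : ℝ) : ℂ) • ξ = 0 := by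
    refine hcyc.eq_zero_of_inner_left ℂ ?_
    rintro _ ⟨a, rfl⟩
    exact key2 a
  have key4 : η = ((‖η‖ ^ 2 : ℝ) : ℂ) • η := by
    have := congrArg P (sub_eq_zero.1 key3)
    rw [map_smul, ← hη, hP, Submodule.starProjection_eq_self_iff.2 hηK] at this
    exact this
  have key5 : (1 - ((‖η‖ ^ 2 : ℝ) : ℂ)) • η = 0 := by
    rw [sub_smul, one_smul, ← key4, sub_self]
  rcases smul_eq_zero.1 key5 with h | h
  · have : ‖η‖ ^ 2 = 1 := by exact_mod_cast (sub_eq_zero.1 h).symm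
    linarith
  · exact hη0 h

/-- If some state takes the value `1` at `e ≤ 1`, then `e` is nonzero in some irreducible
representation. -/
theorem exists_isIrreducibleRep {A : Type} [CStarAlgebra A] [PartialOrder A] [StarOrderedRing A]
    {e : A} (he : e ≤ 1) (hne : (statesAt e).Nonempty) :
    ∃ (K : Type) (_ : NormedAddCommGroup K) (_ : InnerProductSpace ℂ K) (_ : CompleteSpace K)
      (π : A →⋆ₙₐ[ℂ] (K →L[ℂ] K)), IsIrreducibleRep π ∧ π e ≠ 0 := by
  obtain ⟨ψ, hψ⟩ := (isCompact_statesAt e).extremePoints_nonempty hne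
  set f := positiveOfStatesAt hψ.1 with hf
  set ξ : f.GNS := ((f.toPreGNS 1 : f.PreGNS) : f.GNS) with hξ
  have hact : ∀ a, f.gnsNonUnitalStarAlgHom a ξ = ((f.toPreGNS a : f.PreGNS) : f.GNS) := by
    intro a
    simp [hξ]
  have hψa : ∀ a, ⟪ξ, f.gnsNonUnitalStarAlgHom a ξ⟫_ℂ = ψ a := by
    intro a
    rw [hact, hξ, UniformSpace.Completion.inner_coe, PositiveLinearMap.preGNS_inner_def]
    simp [hf]
  have h1 : f.gnsNonUnitalStarAlgHom 1 = 1 := map_one f.gnsStarAlgHom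
  refine ⟨f.GNS, inferInstance, inferInstance, inferInstance, f.gnsNonUnitalStarAlgHom,
    isIrreducibleRep_of_extreme _ h1 he (ξ := ξ) ?_ ?_ ?_, fun h => ?_⟩
  · have := hψa 1
    rw [h1, hψ.1.2.2.2.1, one_apply_eq_self, inner_self_eq_norm_sq_to_K] at this
    have h2 : ‖ξ‖ ^ 2 = 1 := Complex.ofReal_injective (by simpa using this)
    exact (pow_eq_one_iff_of_nonneg (norm_nonneg ξ) two_ne_zero).1 h2
  · have : Set.range (fun a => f.gnsNonUnitalStarAlgHom a ξ) =
        Set.range ((↑) : f.PreGNS → f.GNS) := by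
      ext x
      constructor
      · rintro ⟨a, rfl⟩
        exact ⟨_, (hact a).symm⟩
      · rintro ⟨b, rfl⟩
        exact ⟨f.ofPreGNS b, by simp only [hact]; rfl⟩
    rw [this]
    exact UniformSpace.Completion.denseRange_coe
  · convert hψ using 1
    exact funext hψa
  · have := hψa e
    rw [h, hψ.1.2.2.2.2.1] at this
    simp at this

end PureStates

section VonNeumann

variable {H : Type*} [NormedAddCommGroup H] [InnerProductSpace ℂ H] [CompleteSpace H]

namespace VonNeumannAlgebra

lemma mem_iff_commutant {M : VonNeumannAlgebra H} {x : H →L[ℂ] H} :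
    x ∈ M ↔ ∀ t ∈ M.commutant, t * x = x * t := by
  conv_lhs => rw [← M.commutant_commutant]
  exact mem_commutant_iff

lemma smul_mem' (M : VonNeumannAlgebra H) (c : ℂ) {x : H →L[ℂ] H} (hx : x ∈ M) : c • x ∈ M :=
  SMulMemClass.smul_mem (s := M.toStarSubalgebra) c hx

lemma cfc_mem (M : VonNeumannAlgebra H) {a : H →L[ℂ] H} (ha : a ∈ M) (hsa : IsSelfAdjoint a)
    (f : ℝ → ℝ) : cfc f a ∈ M := by
  rw [mem_iff_commutant]
  intro t ht
  exact (hsa.commute_cfc (mem_iff_commutant.1 ha t ht).symm f).eq.symm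

end VonNeumannAlgebra

/-- The projection onto the closure of the range of an operator. -/
def rangeProj (x : H →L[ℂ] H) : H →L[ℂ] H :=
  x.range.topologicalClosure.starProjection

lemma isStarProjection_rangeProj (x : H →L[ℂ] H) : IsStarProjection (rangeProj x) :=
  isStarProjection_starProjection

lemma rangeProj_mul_self (x : H →L[ℂ] H) : rangeProj x * x = x := by
  ext v
  exact Submodule.starProjection_eq_self_iff.2
    (Submodule.le_topologicalClosure _ (LinearMap.mem_range_self _ v))

lemma mul_rangeProj_eq_zero {x y : H →L[ℂ] H} (h : y * x = 0) : y * rangeProj x = 0 := by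
  have hle : x.range.topologicalClosure ≤ LinearMap.ker (y : H →ₗ[ℂ] H) := by
    refine Submodule.topologicalClosure_minimal _ ?_ y.isClosed_ker
    rintro _ ⟨v, rfl⟩
    exact congrArg (fun T : H →L[ℂ] H => T v) h
  ext v
  exact hle (Submodule.starProjection_apply_mem _ v)

lemma rangeProj_mul_eq_zero {x y : H →L[ℂ] H} (h : star x * y = 0) : rangeProj x * y = 0 := by
  have h1 : star y * x = 0 := by simpa using congrArg star h
  simpa [(isStarProjection_rangeProj x).isSelfAdjoint.star_eq] using
    congrArg star (mul_rangeProj_eq_zero h1)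

lemma rangeProj_mem {M : VonNeumannAlgebra H} {x : H →L[ℂ] H} (hx : x ∈ M) :
    rangeProj x ∈ M := by
  rw [VonNeumannAlgebra.IsStarProjection.mem_iff (isStarProjection_rangeProj x)]
  intro t ht
  rw [rangeProj, Submodule.range_starProjection, Module.End.mem_invtSubmodule]
  refine Submodule.topologicalClosure_minimal _ ?_
    (x.range.isClosed_topologicalClosure.preimage t.continuous)
  rintro _ ⟨v, rfl⟩
  refine Submodule.le_topologicalClosure _ ⟨t v, ?_⟩
  exact congrArg (fun T : H →L[ℂ] H => T v) (VonNeumannAlgebra.mem_iff_commutant.1 hx t ht).symm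

/-- A nonzero element of a von Neumann algebra dominates a nonzero partial isometry. -/
lemma exists_partialIsometry {M : VonNeumannAlgebra H} {x : H →L[ℂ] H} (hx : x ∈ M)
    (hx0 : x ≠ 0) :
    ∃ w ∈ M, w ≠ 0 ∧ IsStarProjection (star w * w) ∧ (∀ y, y * x = 0 → y * w = 0) ∧
      ∀ y, x * y = 0 → w * y = 0 := by
  set a := star x * x with ha
  have haM : a ∈ M := mul_mem (star_mem hx) hx
  have ha0 : 0 ≤ a := star_mul_self_nonneg x
  have hsa : IsSelfAdjoint a := ha0.isSelfAdjoint
  have hane : a ≠ 0 := fun h => hx0 ((CStarRing.star_mul_self_eq_zero_iff x).1 h)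
  set δ := ‖a‖ / 2 with hδ
  have hδ0 : 0 < δ := half_pos (norm_pos_iff.2 hane)
  set g : ℝ → ℝ := fun t => t * max (t - δ) 0 with hg
  set h : ℝ → ℝ := fun t => (√(max t δ))⁻¹ with hh
  have hmax : ∀ t, 0 < max t δ := fun t => lt_max_of_lt_right hδ0
  have hgc : Continuous g := by fun_prop
  have hhc : Continuous h := by
    refine Continuous.inv₀ (by fun_prop) fun t => (Real.sqrt_pos.2 (hmax t)).ne'
  set p := rangeProj (cfc g a) with hp
  have hpp := isStarProjection_rangeProj (cfc g a)
  have hpM : p ∈ M := rangeProj_mem (M.cfc_mem haM hsa g)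
  have hga : cfc g a = a * cfc (fun t => max (t - δ) 0) a := by
    rw [hg, cfc_mul (fun t => t) _ a, cfc_id' ℝ a]
  have hsh : star (cfc h a) = cfc h a := (cfc_predicate h a : IsSelfAdjoint _).star_eq
  have hsg : star (cfc g a) = cfc g a := (cfc_predicate g a : IsSelfAdjoint _).star_eq
  have hk : cfc h a * a * cfc h a * p = p := by
    have h1 : (cfc h a * a * cfc h a - 1) * cfc g a = 0 := by
      have : cfc (fun t => h t * t * h t * g t) a = cfc g a := by
        congr 1
        ext t
        rcases le_total t δ with ht | ht
        · simp [hg, max_eq_right (sub_nonpos.2 ht)]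
        · have h2 : 0 < t := hδ0.trans_le ht
          have h3 : √t ≠ 0 := (Real.sqrt_pos.2 h2).ne'
          have h4 : h t * t * h t = 1 := by
            simp only [hh, max_eq_left ht]
            nth_rewrite 2 [← Real.mul_self_sqrt h2.le]
            field_simp
          rw [h4, one_mul]
      have hhi : Continuous fun t => h t * t := hhc.mul continuous_id
      have hh2 : Continuous fun t => h t * t * h t := hhi.mul hhc
      rw [cfc_mul (fun t => h t * t * h t) g a hh2.continuousOn hgc.continuousOn,
        cfc_mul (fun t => h t * t) h a hhi.continuousOn hhc.continuousOn,
        cfc_mul h (fun t => t) a hhc.continuousOn continuousOn_id, cfc_id' ℝ a] at this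
      rw [sub_mul, this, one_mul, sub_self]
    have := mul_rangeProj_eq_zero h1
    rwa [sub_mul, one_mul, sub_eq_zero] at this
  have hww : star (x * cfc h a * p) * (x * cfc h a * p) = p := by
    calc star (x * cfc h a * p) * (x * cfc h a * p)
        = p * (cfc h a * (star x * x) * cfc h a * p) := by
          simp only [star_mul, hsh, hpp.isSelfAdjoint.star_eq, hp, mul_assoc]
      _ = p := by rw [← ha, hk]; exact hpp.isIdempotentElem
  refine ⟨x * cfc h a * p, mul_mem (mul_mem hx (M.cfc_mem haM hsa h)) hpM, fun h0 => ?_, ?_,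
    fun y hy => ?_, fun y hy => ?_⟩
  · rw [h0, mul_zero] at hww
    have hg0 : cfc g a = 0 := by
      rw [← rangeProj_mul_self (cfc g a), ← hp, ← hww, zero_mul]
    have : Nontrivial (H →L[ℂ] H) := ⟨⟨a, 0, hane⟩⟩
    have h5 := norm_apply_le_norm_cfc g a (CStarAlgebra.norm_mem_spectrum_of_nonneg ha0)
      hgc.continuousOn hsa
    rw [hg0, norm_zero] at h5
    have h6 : g ‖a‖ = 0 := norm_le_zero_iff.1 h5
    have h7 : max (‖a‖ - δ) 0 = δ := by
      rw [max_eq_left (by linarith)]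
      linarith
    simp only [hg, h7] at h6
    rcases mul_eq_zero.1 h6 with h8 | h8
    · exact hane (norm_eq_zero.1 h8)
    · exact hδ0.ne' h8
  · rw [hww]
    exact hpp
  · rw [← mul_assoc, ← mul_assoc, hy, zero_mul, zero_mul]
  · rw [mul_assoc]
    have hcomm : a * cfc (fun t => max (t - δ) 0) a = cfc (fun t => max (t - δ) 0) a * a :=
      (hsa.commute_cfc (Commute.refl a) _).eq.symm
    rw [hp, rangeProj_mul_eq_zero, mul_zero]
    rw [hsg, hga, hcomm, mul_assoc, ha, mul_assoc, hy, mul_zero, mul_zero]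

section Commutative

variable {M : VonNeumannAlgebra H}

lemma projection_commute_of_reduced (hred : ∀ x ∈ M, x * x = 0 → x = 0) {q x : H →L[ℂ] H}
    (hq : IsStarProjection q) (hqM : q ∈ M) (hx : x ∈ M) : Commute q x := by
  have hqq : q * q = q := hq.isIdempotentElem
  have h1q : (1 - q) * q = 0 := by rw [sub_mul, one_mul, hqq, sub_self]
  have hq1 : q * (1 - q) = 0 := by rw [mul_sub, mul_one, hqq, sub_self]
  have hM1 : 1 - q ∈ M := sub_mem (one_mem M) hqM
  have e1 : q * x * (1 - q) = 0 := by
    refine hred _ (mul_mem (mul_mem hqM hx) hM1) ?_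
    rw [mul_assoc (q * x), ← mul_assoc (1 - q), ← mul_assoc (1 - q), h1q]
    simp
  have e2 : (1 - q) * x * q = 0 := by
    refine hred _ (mul_mem (mul_mem hM1 hx) hqM) ?_
    rw [mul_assoc ((1 - q) * x), ← mul_assoc q, ← mul_assoc q, hq1]
    simp
  rw [mul_sub, mul_one, sub_eq_zero] at e1
  rw [sub_mul, sub_mul, one_mul, sub_eq_zero] at e2
  exact e1.trans e2.symm

lemma exists_projection_halving {a : H →L[ℂ] H} (haM : a ∈ M) {δ : ℝ} (ha : 0 ≤ a)
    (haδ : a ≤ (2 * δ) • 1) :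
    ∃ q ∈ M, IsStarProjection q ∧ 0 ≤ a - δ • q ∧ a - δ • q ≤ δ • 1 := by
  have hsa : IsSelfAdjoint a := ha.isSelfAdjoint
  set b := cfc (fun t : ℝ => max (t - δ) 0) a with hb
  set d := cfc (fun t : ℝ => max (δ - t) 0) a with hd
  have hspec : ∀ t ∈ spectrum ℝ a, 0 ≤ t ∧ t ≤ 2 * δ := by
    intro t ht
    refine ⟨spectrum_nonneg_of_nonneg ha ht, ?_⟩
    have : a ≤ algebraMap ℝ _ (2 * δ) := by rwa [Algebra.algebraMap_eq_smul_one]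
    exact (le_algebraMap_iff_spectrum_le (a := a)).1 this t ht
  have hbd : b * d = 0 := by
    rw [hb, hd, ← cfc_mul _ _ a]
    have : (fun t : ℝ => max (t - δ) 0 * max (δ - t) 0) = fun _ => 0 := by
      ext t
      rcases le_total t δ with ht | ht
      · rw [max_eq_right (sub_nonpos.2 ht), zero_mul]
      · rw [max_eq_right (sub_nonpos.2 ht), mul_zero]
    rw [this, cfc_const_zero]
  have hsum : a = δ • 1 + b - d := by
    have h1 : cfc (fun t : ℝ => δ + max (t - δ) 0 - max (δ - t) 0) a = δ • 1 + b - d := by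
      rw [cfc_sub _ _ a, cfc_add _ _ _, cfc_const _ _, Algebra.algebraMap_eq_smul_one]
    rw [← h1]
    conv_lhs => rw [← cfc_id' ℝ a]
    congr 1
    ext t
    rcases le_total t δ with ht | ht
    · rw [max_eq_right (sub_nonpos.2 ht), max_eq_left (sub_nonneg.2 ht)]
      ring
    · rw [max_eq_right (sub_nonpos.2 ht), max_eq_left (sub_nonneg.2 ht)]
      ring
  have hb0 : 0 ≤ b := cfc_nonneg fun t _ => le_max_right _ _
  have hd0 : 0 ≤ d := cfc_nonneg fun t _ => le_max_right _ _
  have hbδ : b ≤ δ • 1 := by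
    rw [← Algebra.algebraMap_eq_smul_one]
    refine cfc_le_algebraMap _ _ _ fun t ht => ?_
    have := hspec t ht
    exact max_le (by linarith) (by linarith)
  have hdδ : d ≤ δ • 1 := by
    rw [← Algebra.algebraMap_eq_smul_one]
    refine cfc_le_algebraMap _ _ _ fun t ht => ?_
    have := hspec t ht
    exact max_le (by linarith) (by linarith)
  set q := rangeProj b with hq
  have hqp : IsStarProjection q := isStarProjection_rangeProj b
  have hqs : star q = q := hqp.isSelfAdjoint.star_eq
  have hqq : q * q = q := hqp.isIdempotentElem
  have hqb : q * b = b := rangeProj_mul_self b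
  have hbq : b * q = b := by
    simpa [hqs, hb0.isSelfAdjoint.star_eq] using congrArg star hqb
  have hqd : q * d = 0 := rangeProj_mul_eq_zero (by rw [hb0.isSelfAdjoint.star_eq, hbd])
  have hdq : d * q = 0 := by
    simpa [hqs, hd0.isSelfAdjoint.star_eq] using congrArg star hqd
  refine ⟨q, rangeProj_mem (M.cfc_mem haM hsa _), hqp, ?_, ?_⟩
  · have h1 := star_left_conjugate_nonneg (sub_nonneg.2 hdδ) (1 - q)
    have h2 : star (1 - q) * (δ • 1 - d) * (1 - q) + b = a - δ • q := by
      rw [star_sub, star_one, hqs, hsum]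
      simp only [mul_sub, sub_mul, one_mul, mul_one, smul_mul_assoc, mul_smul_comm, hqq, hqd,
        hdq, smul_sub, sub_zero]
      abel
    rw [← h2]
    exact add_nonneg h1 hb0
  · have h1 := star_left_conjugate_nonneg (sub_nonneg.2 hbδ) q
    have h2 : star q * (δ • 1 - b) * q + d = δ • 1 - (a - δ • q) := by
      rw [hqs, hsum]
      simp only [mul_sub, sub_mul, mul_one, smul_mul_assoc, mul_smul_comm, hqq, hqb, hbq]
      abel
    rw [← sub_nonneg, ← h2]
    exact add_nonneg h1 hd0

lemma exists_commuting_approx (hred : ∀ x ∈ M, x * x = 0 → x = 0) (m : ℕ) :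
    ∀ {a : H →L[ℂ] H} {c : ℝ}, a ∈ M → 0 ≤ a → a ≤ c • 1 →
      ∃ s, (∀ x ∈ M, Commute s x) ∧ 0 ≤ a - s ∧ a - s ≤ (c / 2 ^ m) • 1 := by
  induction m with
  | zero =>
    intro a c _ ha hac
    exact ⟨0, fun x _ => Commute.zero_left x, by simpa using ha, by simpa using hac⟩
  | succ m ih =>
    intro a c haM ha hac
    obtain ⟨q, hqM, hq, h1, h2⟩ := exists_projection_halving (δ := c / 2) haM ha
      (by rwa [mul_div_cancel₀ c two_ne_zero])
    have hqM' : (c / 2) • q ∈ M := by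
      have := M.smul_mem' ((c / 2 : ℝ) : ℂ) hqM
      rwa [Complex.coe_smul] at this
    obtain ⟨s, hs, h3, h4⟩ := ih (sub_mem haM hqM') h1 h2
    refine ⟨(c / 2) • q + s, fun x hx =>
      ((projection_commute_of_reduced hred hq hqM hx).smul_left _).add_left (hs x hx), ?_, ?_⟩
    · rwa [← sub_sub]
    · rw [← sub_sub, pow_succ', ← div_div]
      exact h4

/-- A von Neumann algebra without nonzero square-zero elements is commutative. -/
theorem commute_of_reduced (hred : ∀ x ∈ M, x * x = 0 → x = 0) {x y : H →L[ℂ] H} (hx : x ∈ M)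
    (hy : y ∈ M) : Commute x y := by
  have hpos : ∀ a ∈ M, 0 ≤ a → Commute a y := by
    intro a haM ha
    have hle : a ≤ ‖a‖ • 1 := by
      rw [← Algebra.algebraMap_eq_smul_one]
      exact ha.isSelfAdjoint.le_algebraMap_norm_self
    have hbound : ∀ m : ℕ, ‖a * y - y * a‖ ≤ 2 * ‖y‖ * ‖a‖ * (1 / 2) ^ m := by
      intro m
      obtain ⟨s, hs, h1, h2⟩ := exists_commuting_approx hred m haM ha hle
      have hn : ‖a - s‖ ≤ ‖a‖ / 2 ^ m := by
        rw [CStarAlgebra.norm_le_iff_le_algebraMap _ (by positivity) h1,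
          Algebra.algebraMap_eq_smul_one]
        exact h2
      have : a * y - y * a = (a - s) * y - y * (a - s) := by
        rw [sub_mul, mul_sub, (hs y hy).eq]
        abel
      rw [this]
      calc ‖(a - s) * y - y * (a - s)‖ ≤ ‖(a - s) * y‖ + ‖y * (a - s)‖ := norm_sub_le _ _
        _ ≤ ‖a - s‖ * ‖y‖ + ‖y‖ * ‖a - s‖ := add_le_add (norm_mul_le _ _) (norm_mul_le _ _)
        _ = 2 * ‖y‖ * ‖a - s‖ := by ring
        _ ≤ 2 * ‖y‖ * (‖a‖ / 2 ^ m) := by gcongr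
        _ = 2 * ‖y‖ * ‖a‖ * (1 / 2) ^ m := by rw [one_div, inv_pow]; ring
    have hlim : Filter.Tendsto (fun m : ℕ => 2 * ‖y‖ * ‖a‖ * (1 / 2 : ℝ) ^ m) Filter.atTop
        (nhds (2 * ‖y‖ * ‖a‖ * 0)) :=
      (tendsto_pow_atTop_nhds_zero_of_lt_one (by norm_num) (by norm_num)).const_mul _
    have h0 := ge_of_tendsto' hlim hbound
    rw [mul_zero] at h0
    exact sub_eq_zero.1 (norm_le_zero_iff.1 h0)
  have hsa : ∀ a ∈ M, IsSelfAdjoint a → Commute a y := by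
    intro a haM ha
    have hM1 : ‖a‖ • (1 : H →L[ℂ] H) ∈ M := by
      have := M.smul_mem' (‖a‖ : ℂ) (one_mem M)
      rwa [Complex.coe_smul] at this
    have h1 : 0 ≤ a + ‖a‖ • 1 := by
      have := ha.neg_algebraMap_norm_le_self
      rw [Algebra.algebraMap_eq_smul_one] at this
      exact neg_le_iff_add_nonneg.1 this
    have h2 := (hpos _ (add_mem haM hM1) h1).sub_left ((Commute.one_left y).smul_left ‖a‖)
    rwa [add_sub_cancel_right] at h2
  have hxs := star_mem hx
  rw [← realPart_add_I_smul_imaginaryPart x]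
  refine (hsa _ ?_ (realPart x).2).add_left ((hsa _ ?_ (imaginaryPart x).2).smul_left _)
  · rw [realPart_apply_coe, ← Complex.coe_smul]
    exact M.smul_mem' _ (add_mem hx hxs)
  · rw [imaginaryPart_apply_coe, ← Complex.coe_smul (2⁻¹ : ℝ)]
    exact M.smul_mem' _ (M.smul_mem' _ (sub_mem hx hxs))

end Commutative

end VonNeumann

section Corner

open ContinuousLinearMap

variable {H K : Type*} [NormedAddCommGroup H] [InnerProductSpace ℂ H] [CompleteSpace H]
  [NormedAddCommGroup K] [InnerProductSpace ℂ K] [CompleteSpace K]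

/-- The transport of operators along an isometry `ι`. -/
def conjBy (ι : K →L[ℂ] H) (b : K →L[ℂ] K) : H →L[ℂ] H :=
  ι ∘L b ∘L ι.adjoint

variable {ι : K →L[ℂ] H}

lemma conjBy_apply (b : K →L[ℂ] K) (v : H) : conjBy ι b v = ι (b (ι.adjoint v)) := rfl

lemma conjBy_add (b c : K →L[ℂ] K) : conjBy ι (b + c) = conjBy ι b + conjBy ι c := by
  ext v; simp [conjBy_apply]

lemma conjBy_smul (r : ℂ) (b : K →L[ℂ] K) : conjBy ι (r • b) = r • conjBy ι b := by
  ext v; simp [conjBy_apply]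

lemma conjBy_zero : conjBy ι (0 : K →L[ℂ] K) = 0 := by
  ext v; simp [conjBy_apply]

lemma star_conjBy (b : K →L[ℂ] K) : star (conjBy ι b) = conjBy ι (star b) := by
  simp only [conjBy, star_eq_adjoint, adjoint_comp, adjoint_adjoint, comp_assoc]

lemma adjoint_apply_self (h : ι.adjoint ∘L ι = 1) (v : K) : ι.adjoint (ι v) = v :=
  congrArg (fun T : K →L[ℂ] K => T v) h

lemma conjBy_mul (h : ι.adjoint ∘L ι = 1) (b c : K →L[ℂ] K) :
    conjBy ι (b * c) = conjBy ι b * conjBy ι c := by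
  ext v; simp [conjBy_apply, adjoint_apply_self h]

lemma conjBy_injective (h : ι.adjoint ∘L ι = 1) : Function.Injective (conjBy ι) := by
  intro b c hbc
  ext v
  have := congrArg (fun T : H →L[ℂ] H => ι.adjoint (T (ι v))) hbc
  simpa [conjBy_apply, adjoint_apply_self h] using this

lemma conjBy_adjoint_comp (x : H →L[ℂ] H) :
    conjBy ι (ι.adjoint ∘L x ∘L ι) = (ι ∘L ι.adjoint) * x * (ι ∘L ι.adjoint) := rfl

/-- The reduction of a von Neumann algebra to the range of an isometry `ι` whose range projection
belongs to the algebra. -/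
def cornerAlgebra (M : VonNeumannAlgebra H) (ι : K →L[ℂ] H) (h : ι.adjoint ∘L ι = 1)
    (hM : ι ∘L ι.adjoint ∈ M) : VonNeumannAlgebra K where
  carrier := {b | conjBy ι b ∈ M}
  mul_mem' {b c} hb hc := by
    change conjBy ι (b * c) ∈ M
    rw [conjBy_mul h]
    exact mul_mem hb hc
  add_mem' {b c} hb hc := by
    change conjBy ι (b + c) ∈ M
    rw [conjBy_add]
    exact add_mem hb hc
  algebraMap_mem' r := by
    change conjBy ι (algebraMap ℂ _ r) ∈ M
    rw [Algebra.algebraMap_eq_smul_one, conjBy_smul]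
    exact M.smul_mem' r hM
  star_mem' {b} hb := by
    change conjBy ι (star b) ∈ M
    rw [← star_conjBy]
    exact star_mem hb
  centralizer_centralizer' := by
    refine subset_antisymm (fun T hT => ?_) Set.subset_centralizer_centralizer
    refine VonNeumannAlgebra.mem_iff_commutant.2 fun t ht => ?_
    have hcomm : ∀ v, t (ι (ι.adjoint v)) = ι (ι.adjoint (t v)) := fun v =>
      congrArg (fun T : H →L[ℂ] H => T v) (VonNeumannAlgebra.mem_iff_commutant.1 hM t ht)
    have hred : ι.adjoint ∘L t ∘L ι ∈ Set.centralizer {b | conjBy ι b ∈ M} := by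
      intro b hb
      refine conjBy_injective h ?_
      have hb' := VonNeumannAlgebra.mem_iff_commutant.1 hb t ht
      ext v
      have h2 : t (ι (b (ι.adjoint v))) = ι (b (ι.adjoint (t v))) :=
        congrArg (fun T : H →L[ℂ] H => T v) hb'
      simp only [conjBy_apply, mul_apply_eq_comp, comp_apply]
      rw [← hcomm, adjoint_apply_self h, hcomm, adjoint_apply_self h, h2]
    have h3 := hT _ hred
    ext v
    have h4 := congrArg (fun S : K →L[ℂ] K => ι (S (ι.adjoint v))) h3
    simp only [mul_apply_eq_comp, comp_apply] at h4
    simp only [conjBy_apply, mul_apply_eq_comp]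
    rw [hcomm, adjoint_apply_self h, ← hcomm, adjoint_apply_self h] at h4
    exact h4

lemma mem_cornerAlgebra {M : VonNeumannAlgebra H} {h : ι.adjoint ∘L ι = 1}
    {hM : ι ∘L ι.adjoint ∈ M} {b : K →L[ℂ] K} :
    b ∈ cornerAlgebra M ι h hM ↔ conjBy ι b ∈ M := Iff.rfl

lemma adjoint_comp_mem_cornerAlgebra {M : VonNeumannAlgebra H} {h : ι.adjoint ∘L ι = 1}
    {hM : ι ∘L ι.adjoint ∈ M} {x : H →L[ℂ] H} (hx : x ∈ M) :
    ι.adjoint ∘L x ∘L ι ∈ cornerAlgebra M ι h hM := by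
  rw [mem_cornerAlgebra, conjBy_adjoint_comp]
  exact mul_mem (mul_mem hM hx) hM

end Corner

section Frames

variable {H : Type*} [NormedAddCommGroup H] [InnerProductSpace ℂ H] [CompleteSpace H]

/-- A family of `k` partial isometries in `M` with common initial projection `p`, whose ranges are
pairwise orthogonal and lie below `z`. -/
@[ext]
structure Frame (M : VonNeumannAlgebra H) (k : ℕ) (z : H →L[ℂ] H) where
  u : Fin k → H →L[ℂ] H
  p : H →L[ℂ] H
  u_mem : ∀ i, u i ∈ M
  p_mem : p ∈ M
  proj : IsStarProjection p
  star_u_mul_u : ∀ i j, star (u i) * u j = if i = j then p else 0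
  z_mul : ∀ i, z * u i = u i

namespace Frame

variable {M : VonNeumannAlgebra H} {k : ℕ} {z : H →L[ℂ] H}

lemma p_mul_p (F : Frame M k z) : F.p * F.p = F.p := F.proj.isIdempotentElem

lemma star_p (F : Frame M k z) : star F.p = F.p := F.proj.isSelfAdjoint.star_eq

lemma star_mul_same (F : Frame M k z) (i : Fin k) : star (F.u i) * F.u i = F.p := by
  rw [F.star_u_mul_u, if_pos rfl]

lemma u_mul_p (F : Frame M k z) (i : Fin k) : F.u i * F.p = F.u i := by
  have h : star (F.u i * F.p - F.u i) * (F.u i * F.p - F.u i) = 0 := by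
    have h1 : star (F.u i * F.p - F.u i) * (F.u i * F.p - F.u i)
        = F.p * (star (F.u i) * F.u i) * F.p - F.p * (star (F.u i) * F.u i)
          - (star (F.u i) * F.u i) * F.p + star (F.u i) * F.u i := by
      rw [star_sub, star_mul, F.star_p]
      noncomm_ring
    rw [h1, F.star_mul_same]
    simp only [F.p_mul_p]
    abel
  exact sub_eq_zero.1 ((CStarRing.star_mul_self_eq_zero_iff _).1 h)

lemma norm_u_le (F : Frame M k z) (i : Fin k) : ‖F.u i‖ ≤ 1 := by
  have h1 := CStarRing.norm_star_mul_self (x := F.u i)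
  rw [F.star_mul_same] at h1
  have h2 := F.proj.norm_le
  nlinarith [norm_nonneg (F.u i)]

lemma exists_cons {a p : H →L[ℂ] H} {b : Fin k → H →L[ℂ] H} (ha : a ∈ M) (hb : ∀ i, b i ∈ M)
    (hp : IsStarProjection p) (haa : star a * a = p)
    (hbb : ∀ i j, star (b i) * b j = if i = j then p else 0) (hab : ∀ i, star a * b i = 0)
    (hza : z * a = a) (hzb : ∀ i, z * b i = b i) : ∃ F : Frame M (k + 1) z, F.p = p := by
  refine ⟨⟨Fin.cons a b, p, Fin.cases ha hb, haa ▸ mul_mem (star_mem ha) ha, hp, ?_,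
    Fin.cases hza hzb⟩, rfl⟩
  have hba : ∀ i, star (b i) * a = 0 := fun i => by simpa using congrArg star (hab i)
  intro i j
  cases i using Fin.cases <;> cases j using Fin.cases <;>
    simp [haa, hbb, hab, hba, Fin.succ_ne_zero, (Fin.succ_ne_zero _).symm]

end Frame

end Frames

section NoBigFrame

open InnerProductSpace

variable {H : Type} [NormedAddCommGroup H] [InnerProductSpace ℂ H] [CompleteSpace H]

/-- In an `n`-subhomogeneous von Neumann algebra, a frame of `n + 1` elements vanishes. -/
theorem Frame.p_eq_zero_of_isSubhomogeneous {M : VonNeumannAlgebra H} {n : ℕ}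
    (hM : IsSubhomogeneous n M.toStarSubalgebra) {z : H →L[ℂ] H} (F : Frame M (n + 1) z) :
    F.p = 0 := by
  by_contra hp
  have hclosed : IsClosed (M.toStarSubalgebra : Set (H →L[ℂ] H)) := by
    rw [VonNeumannAlgebra.coe_toStarSubalgebra, ← M.centralizer_centralizer]
    exact Set.isClosed_centralizer _
  let : CStarAlgebra M.toStarSubalgebra := StarSubalgebra.cstarAlgebra _ (h_closed := hclosed)
  let : PartialOrder M.toStarSubalgebra := CStarAlgebra.spectralOrder _
  have : StarOrderedRing M.toStarSubalgebra := CStarAlgebra.spectralOrderedRing _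
  let e : M.toStarSubalgebra := ⟨F.p, F.p_mem⟩
  let u : Fin (n + 1) → M.toStarSubalgebra := fun i => ⟨F.u i, F.u_mem i⟩
  have hsu : ∀ i j, star (u i) * u j = if i = j then e else 0 := by
    intro i j
    ext1
    have := F.star_u_mul_u i j
    split_ifs with h
    · rwa [if_pos h] at this
    · rwa [if_neg h] at this
  have hee : e * e = e := Subtype.ext F.p_mul_p
  have hse : star e = e := Subtype.ext F.star_p
  have hne : (statesAt e).Nonempty := by
    obtain ⟨w, hw⟩ : ∃ w, F.p w ≠ 0 := by
      by_contra! h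
      exact hp (ContinuousLinearMap.ext h)
    let π : M.toStarSubalgebra →⋆ₙₐ[ℂ] (H →L[ℂ] H) :=
      (M.toStarSubalgebra.subtype : M.toStarSubalgebra →⋆ₙₐ[ℂ] (H →L[ℂ] H))
    refine ⟨_, vectorState_mem π rfl hw ?_⟩
    have : π e (F.p w) = F.p w := congrArg (fun T : H →L[ℂ] H => T w) F.p_mul_p
    rw [this, inner_self_eq_norm_sq_to_K]
    simp
  obtain ⟨K, _, _, _, π, hπ, hπe⟩ := exists_isIrreducibleRep (IsStarProjection.le_one ⟨hee, hse⟩) hne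
  obtain ⟨w, hw⟩ : ∃ w, π e w ≠ 0 := by
    by_contra! h
    exact hπe (ContinuousLinearMap.ext h)
  have hpe : π e (π e w) = π e w := by
    rw [← mul_apply_eq_comp, ← map_mul, hee]
  have hin : ∀ i j, ⟪π (u i) (π e w), π (u j) (π e w)⟫_ℂ
      = if i = j then ⟪π e w, π e w⟫_ℂ else 0 := by
    intro i j
    rw [← ContinuousLinearMap.adjoint_inner_right, ← ContinuousLinearMap.star_eq_adjoint,
      ← map_star, ← mul_apply_eq_comp, ← map_mul, hsu]
    split_ifs with h
    · rw [hpe]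
    · simp
  have hli : LinearIndependent ℂ fun i => π (u i) (π e w) := by
    refine linearIndependent_of_ne_zero_of_inner_eq_zero (fun i h0 => ?_) fun i j hij => ?_
    · have := hin i i
      rw [if_pos rfl, h0, inner_zero_left] at this
      exact hw (inner_self_eq_zero.1 this.symm)
    · exact (hin i j).trans (if_neg hij)
  have h1 := hli.cardinal_le_rank.trans (hM K π hπ)
  rw [Cardinal.mk_fin] at h1
  have h2 : n + 1 ≤ n := by exact_mod_cast h1
  omega

end NoBigFrame

section Maximal

open Filter Topology InnerProductSpace

variable {H : Type*} [NormedAddCommGroup H] [InnerProductSpace ℂ H]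

lemma exists_strongLimit {α : Type*} {l : Filter α} [l.NeBot] {T : α → H →L[ℂ] H}
    (hb : ∀ a, ‖T a‖ ≤ 1) (hc : ∀ x, ∃ y, Tendsto (fun a => T a x) l (𝓝 y)) :
    ∃ L : H →L[ℂ] H, ∀ x, Tendsto (fun a => T a x) l (𝓝 (L x)) := by
  choose f hf using hc
  refine ⟨ContinuousLinearMap.ofTendstoOfBoundedRange f T (tendsto_pi_nhds.2 hf) ?_, hf⟩
  rw [isBounded_iff_forall_norm_le]
  exact ⟨1, by rintro _ ⟨a, rfl⟩; exact hb a⟩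

variable [CompleteSpace H]

lemma VonNeumannAlgebra.mem_of_tendsto {M : VonNeumannAlgebra H} {α : Type*} {l : Filter α}
    [l.NeBot] {T : α → H →L[ℂ] H} (hT : ∀ a, T a ∈ M) {L : H →L[ℂ] H}
    (hL : ∀ x, Tendsto (fun a => T a x) l (𝓝 (L x))) : L ∈ M := by
  refine mem_iff_commutant.2 fun t ht => ?_
  ext x
  refine tendsto_nhds_unique ((t.continuous.tendsto _).comp (hL x)) ((hL (t x)).congr fun a => ?_)
  exact (congrArg (fun S : H →L[ℂ] H => S x) (mem_iff_commutant.1 (hT a) t ht)).symm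

namespace Frame

variable {M : VonNeumannAlgebra H} {k : ℕ} {z : H →L[ℂ] H}

/-- Frames are ordered by extension of their partial isometries. -/
instance : Preorder (Frame M k z) where
  le f g := g.p * f.p = f.p ∧ ∀ i, g.u i * f.p = f.u i
  le_refl f := ⟨f.p_mul_p, f.u_mul_p⟩
  le_trans f g h hfg hgh := by
    refine ⟨?_, fun i => ?_⟩
    · rw [← hfg.1, ← mul_assoc, hgh.1]
    · rw [← hfg.1, ← mul_assoc, hgh.2, hfg.2]

/-- The zero frame. -/
instance : Nonempty (Frame M k z) :=
  ⟨⟨fun _ => 0, 0, fun _ => zero_mem M, zero_mem M, .zero _, by simp, by simp⟩⟩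

lemma u_sub_u {f g : Frame M k z} (h : f ≤ g) (i : Fin k) :
    g.u i - f.u i = g.u i * (g.p - f.p) := by
  rw [mul_sub, g.u_mul_p, h.2]

lemma bddAbove_of_isChain {c : Set (Frame M k z)} (hc : IsChain (· ≤ ·) c) (hne : c.Nonempty) :
    BddAbove c := by
  have : Nonempty c := hne.to_subtype
  have : IsDirectedOrder c := directedOn_iff_isDirectedOrder.1 hc.directedOn
  choose U _ hU using fun f : c => isStarProjection_iff_eq_starProjection.1 f.1.proj
  have hUmono : Monotone U := by
    intro f g hfg x hx
    have h1 : f.1.p x = x := by rw [hU f]; exact Submodule.starProjection_eq_self_iff.2 hx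
    have h2 : g.1.p (f.1.p x) = f.1.p x :=
      congrArg (fun T : H →L[ℂ] H => T x) (show f.1 ≤ g.1 from hfg).1
    rw [h1, hU g] at h2
    exact Submodule.starProjection_eq_self_iff.1 h2
  obtain ⟨P, hPproj, hP⟩ : ∃ P : H →L[ℂ] H, IsStarProjection P ∧
      ∀ x, Tendsto (fun f : c => f.1.p x) atTop (𝓝 (P x)) := by
    refine ⟨(⨆ f, U f).topologicalClosure.starProjection, isStarProjection_starProjection,
      fun x => ?_⟩
    refine (Submodule.starProjection_tendsto_closure_iSup U hUmono x).congr fun f => ?_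
    rw [hU f]
  have hL : ∀ i, ∃ L : H →L[ℂ] H, ∀ x, Tendsto (fun f : c => f.1.u i x) atTop (𝓝 (L x)) := by
    refine fun i => exists_strongLimit (fun f => f.1.norm_u_le i) fun x => ?_
    refine cauchy_map_iff_exists_tendsto.1 (Metric.cauchy_iff.2 ⟨inferInstance, fun ε hε => ?_⟩)
    obtain ⟨f₀, hf₀⟩ := eventually_atTop.1 (Metric.tendsto_nhds.1 (hP x) (ε / 4) (by linarith))
    have hclose : ∀ f, f₀ ≤ f → dist (f.1.u i x) (f₀.1.u i x) < ε / 2 := by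
      intro f hf
      have h1 : f.1.u i x - f₀.1.u i x = f.1.u i (f.1.p x - f₀.1.p x) :=
        congrArg (fun T : H →L[ℂ] H => T x) (u_sub_u (show f₀.1 ≤ f.1 from hf) i)
      have h2 := f.1.norm_u_le i
      have h3 := (dist_triangle_right (f.1.p x) (f₀.1.p x) (P x)).trans_lt
        (add_lt_add (hf₀ f hf) (hf₀ f₀ le_rfl))
      rw [dist_eq_norm, h1]
      rw [dist_eq_norm] at h3
      calc ‖f.1.u i (f.1.p x - f₀.1.p x)‖ ≤ 1 * ‖f.1.p x - f₀.1.p x‖ :=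
            (f.1.u i).le_of_opNorm_le h2 _
        _ < ε / 2 := by linarith
    refine ⟨_, image_mem_map (mem_atTop f₀), ?_⟩
    rintro _ ⟨f, hf, rfl⟩ _ ⟨g, hg, rfl⟩
    have := (dist_triangle_right (f.1.u i x) (g.1.u i x) (f₀.1.u i x)).trans_lt
      (add_lt_add (hclose f hf) (hclose g hg))
    linarith
  choose L hL using hL
  have hLM : ∀ i, L i ∈ M :=
    fun i => VonNeumannAlgebra.mem_of_tendsto (fun f : c => f.1.u_mem i) (hL i)
  have hPM : P ∈ M := VonNeumannAlgebra.mem_of_tendsto (fun f : c => f.1.p_mem) hP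
  refine ⟨⟨L, P, hLM, hPM, hPproj, fun i j => ?_, fun i => ?_⟩, fun f hf => ⟨?_, fun i => ?_⟩⟩
  · ext x
    refine ext_inner_left ℂ fun y => ?_
    rw [mul_apply_eq_comp, ContinuousLinearMap.star_eq_adjoint,
      ContinuousLinearMap.adjoint_inner_right]
    refine tendsto_nhds_unique ((hL i y).inner (hL j x)) ?_
    have h1 : ∀ f : c, ⟪f.1.u i y, f.1.u j x⟫_ℂ
        = ⟪y, (if i = j then f.1.p else 0 : H →L[ℂ] H) x⟫_ℂ := by
      intro f
      rw [← f.1.star_u_mul_u i j, mul_apply_eq_comp, ContinuousLinearMap.star_eq_adjoint,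
        ContinuousLinearMap.adjoint_inner_right]
    simp only [h1]
    split_ifs
    · exact tendsto_const_nhds.inner (hP x)
    · exact tendsto_const_nhds
  · ext x
    refine tendsto_nhds_unique ((z.continuous.tendsto _).comp (hL i x))
      ((hL i x).congr fun f => ?_)
    exact (congrArg (fun T : H →L[ℂ] H => T x) (f.1.z_mul i)).symm
  · ext x
    refine tendsto_nhds_unique (hP (f.p x)) (tendsto_const_nhds.congr' ?_)
    filter_upwards [eventually_ge_atTop (⟨f, hf⟩ : c)] with g hg
    exact (congrArg (fun T : H →L[ℂ] H => T x) (show f ≤ g.1 from hg).1).symm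
  · ext x
    refine tendsto_nhds_unique (hL i (f.p x)) (tendsto_const_nhds.congr' ?_)
    filter_upwards [eventually_ge_atTop (⟨f, hf⟩ : c)] with g hg
    exact (congrArg (fun T : H →L[ℂ] H => T x) ((show f ≤ g.1 from hg).2 i)).symm

lemma exists_isMax (M : VonNeumannAlgebra H) (k : ℕ) (z : H →L[ℂ] H) :
    ∃ F : Frame M k z, IsMax F :=
  zorn_le_nonempty fun _ => bddAbove_of_isChain

end Frame

end Maximal

section Splitting

variable {H : Type*} [NormedAddCommGroup H] [InnerProductSpace ℂ H] [CompleteSpace H]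

namespace Frame

variable {M : VonNeumannAlgebra H} {k : ℕ} {z : H →L[ℂ] H}

/-- The sum of the range projections of a frame. -/
def q (F : Frame M k z) : H →L[ℂ] H := ∑ i, F.u i * star (F.u i)

lemma star_q (F : Frame M k z) : star F.q = F.q := by
  simp [q, star_sum]

lemma q_mem (F : Frame M k z) : F.q ∈ M :=
  sum_mem fun i _ => mul_mem (F.u_mem i) (star_mem (F.u_mem i))

lemma q_mul_u (F : Frame M k z) (j : Fin k) : F.q * F.u j = F.u j := by
  simp [q, Finset.sum_mul, mul_assoc, F.star_u_mul_u, F.u_mul_p]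

lemma star_u_mul_q (F : Frame M k z) (j : Fin k) : star (F.u j) * F.q = star (F.u j) := by
  simpa [F.star_q] using congrArg star (F.q_mul_u j)

lemma q_mul_q (F : Frame M k z) : F.q * F.q = F.q := by
  nth_rewrite 2 3 [q]
  simp only [Finset.mul_sum, ← mul_assoc, F.q_mul_u]

lemma z_mul_q (F : Frame M k z) : z * F.q = F.q := by
  simp only [q, Finset.mul_sum, ← mul_assoc, F.z_mul]

lemma p_mul_star_u (F : Frame M k z) (i : Fin k) : F.p * star (F.u i) = star (F.u i) := by
  simpa [F.star_p] using congrArg star (F.u_mul_p i)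

/-- If `w` is a partial isometry with initial projection below that of `F` and orthogonal to the
restriction of `F`, then `F` can be enlarged. -/
lemma eq_zero_of_orthogonal (hno : ∀ G : Frame M (k + 1) z, G.p = 0) (F : Frame M k z)
    {a w : H →L[ℂ] H} (ha : a ∈ M) (hw : IsStarProjection (star w * w)) (hwM : w ∈ M)
    (haw : star a * a = star w * w) (hwp : w * F.p = w)
    (hab : ∀ i, star a * (F.u i * (star w * w)) = 0) (hza : z * a = a) : w = 0 := by
  have hpw : F.p * (star w * w) = star w * w := by
    rw [← mul_assoc]
    congr 1
    simpa [F.star_p] using congrArg star hwp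
  obtain ⟨G, hG⟩ := exists_cons (z := z) (b := fun i => F.u i * (star w * w)) ha
    (fun i => mul_mem (F.u_mem i) (mul_mem (star_mem hwM) hwM)) hw haw
    (fun i j => by
      have : star (F.u i * (star w * w)) * (F.u j * (star w * w))
          = star w * w * (star (F.u i) * F.u j) * (star w * w) := by
        simp only [star_mul, star_star, mul_assoc]
      rw [this, F.star_u_mul_u]
      split_ifs
      · rw [mul_assoc, hpw, hw.isIdempotentElem.eq]
      · simp)
    hab hza (fun i => by rw [← mul_assoc, F.z_mul])
  exact (CStarRing.star_mul_self_eq_zero_iff w).1 (hG ▸ hno G)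

lemma reduced_corner (hno : ∀ G : Frame M (k + 2) z, G.p = 0) (F : Frame M (k + 1) z)
    {x : H →L[ℂ] H} (hx : x ∈ M) (hpx : F.p * x = x) (hxp : x * F.p = x) (hxx : x * x = 0) :
    x = 0 := by
  by_contra hx0
  obtain ⟨w, hwM, hw0, hw, hl, hr⟩ := exists_partialIsometry hx hx0
  have hpw : F.p * w = w := by
    have := hl (1 - F.p) (by rw [sub_mul, one_mul, hpx, sub_self])
    rw [sub_mul, one_mul, sub_eq_zero] at this
    exact this.symm
  have hwp : w * F.p = w := by
    have := hr (1 - F.p) (by rw [mul_sub, mul_one, hxp, sub_self])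
    rw [mul_sub, mul_one, sub_eq_zero] at this
    exact this.symm
  have hww : star w * star w = 0 := by
    rw [← star_mul, hr w (hl x hxx), star_zero]
  refine hw0 (eq_zero_of_orthogonal hno F (a := F.u 0 * w) (mul_mem (F.u_mem 0) hwM) hw hwM ?_ hwp
    (fun i => ?_) ?_)
  · rw [star_mul, mul_assoc, ← mul_assoc (star (F.u 0)), F.star_mul_same, hpw]
  · have : star (F.u 0 * w) * (F.u i * (star w * w))
        = star w * (star (F.u 0) * F.u i) * star w * w := by
      simp only [star_mul, mul_assoc]
    rw [this, F.star_u_mul_u]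
    split_ifs
    · have hwp' : star w * F.p = star w := by simpa [F.star_p] using congrArg star hpw
      rw [hwp', hww, zero_mul]
    · simp
  · rw [← mul_assoc, F.z_mul]

lemma q_central (hno : ∀ G : Frame M (k + 1) z, G.p = 0) (hz : ∀ x ∈ M, Commute z x)
    (F : Frame M k z) {x : H →L[ℂ] H} (hx : x ∈ M) : Commute F.q x := by
  have hqu : ∀ x ∈ M, ∀ i, (1 - F.q) * x * F.u i = 0 := by
    intro x hx i
    by_contra hy0
    have h1q : 1 - F.q ∈ M := sub_mem (one_mem M) F.q_mem
    have hqx : (1 - F.q) * x ∈ M := mul_mem h1q hx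
    obtain ⟨w, hwM, hw0, hw, hl, hr⟩ :=
      exists_partialIsometry (mul_mem hqx (F.u_mem i)) hy0
    have hqw : F.q * w = 0 := hl _ (by
      rw [← mul_assoc, ← mul_assoc, mul_sub, mul_one, F.q_mul_q, sub_self, zero_mul, zero_mul])
    have hwp : w * F.p = w := by
      have := hr (1 - F.p) (by rw [mul_sub, mul_one, mul_assoc _ (F.u i), F.u_mul_p, sub_self])
      rw [mul_sub, mul_one, sub_eq_zero] at this
      exact this.symm
    have hzw : z * w = w := by
      have := hl (1 - z) (by
        rw [sub_mul, one_mul, ← mul_assoc z, (hz _ hqx).eq, mul_assoc _ z, F.z_mul, sub_self])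
      rw [sub_mul, one_mul, sub_eq_zero] at this
      exact this.symm
    refine hw0 (eq_zero_of_orthogonal hno F hwM hw hwM rfl hwp (fun j => ?_) hzw)
    have hwq : star w * F.q = 0 := by simpa [F.star_q] using congrArg star hqw
    rw [← F.q_mul_u j, ← mul_assoc, ← mul_assoc (star w), hwq, zero_mul, zero_mul]
  have hqxq : ∀ x ∈ M, x * F.q = F.q * x * F.q := by
    intro x hx
    have : (1 - F.q) * x * F.q = 0 := by
      nth_rewrite 2 [q]
      simp only [Finset.mul_sum, ← mul_assoc, hqu x hx, zero_mul, Finset.sum_const_zero]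
    rwa [sub_mul, sub_mul, one_mul, sub_eq_zero] at this
  have h1 := congrArg star (hqxq _ (star_mem hx))
  simp only [star_mul, star_star, F.star_q] at h1
  rw [← mul_assoc, ← hqxq x hx] at h1
  exact h1

lemma eq_zero_of_isMax {F : Frame M (k + 1) z} (hF : IsMax F) (hzz : z * z = z)
    (hq : ∀ x ∈ M, Commute F.q x) (hqz : F.q * z = F.q) (F' : Frame M (k + 1) (z - F.q)) :
    F'.p = 0 := by
  have hqu' : ∀ i, F.q * F'.u i = 0 := fun i => by
    rw [← F'.z_mul i, ← mul_assoc, mul_sub, hqz, F.q_mul_q, sub_self, zero_mul]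
  have huu' : ∀ i j, star (F.u i) * F'.u j = 0 := fun i j => by
    rw [← F.star_u_mul_q, mul_assoc, hqu', mul_zero]
  have hu'u : ∀ i j, star (F'.u i) * F.u j = 0 := fun i j => by
    simpa using congrArg star (huu' j i)
  have hqp' : F.q * F'.p = 0 := by
    rw [(hq _ F'.p_mem).eq, ← F'.star_mul_same 0, mul_assoc, ← (hq _ (F'.u_mem 0)).eq, hqu',
      mul_zero]
  have hup' : ∀ i, F.u i * F'.p = 0 := fun i => by
    rw [← F.q_mul_u i, (hq _ (F.u_mem i)).eq, mul_assoc, hqp', mul_zero]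
  have hpp' : F.p * F'.p = 0 := by
    rw [← F.star_mul_same 0, mul_assoc, hup', mul_zero]
  have hp'p : F'.p * F.p = 0 := by
    simpa [F.star_p, F'.star_p] using congrArg star hpp'
  let G : Frame M (k + 1) z :=
    { u := fun i => F.u i + F'.u i
      p := F.p + F'.p
      u_mem := fun i => add_mem (F.u_mem i) (F'.u_mem i)
      p_mem := add_mem F.p_mem F'.p_mem
      proj := F.proj.add F'.proj hpp'
      star_u_mul_u := fun i j => by
        simp only [star_add, add_mul, mul_add, huu', hu'u, F.star_u_mul_u, F'.star_u_mul_u]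
        split_ifs <;> simp
      z_mul := fun i => by
        rw [mul_add, F.z_mul]
        nth_rewrite 1 [← F'.z_mul i]
        rw [← mul_assoc, mul_sub, hzz, F.z_mul_q, F'.z_mul] }
  have hFG : F ≤ G := by
    refine ⟨?_, fun i => ?_⟩
    · change (F.p + F'.p) * F.p = F.p
      rw [add_mul, hp'p, F.p_mul_p, add_zero]
    · change (F.u i + F'.u i) * F.p = F.u i
      rw [add_mul, F.u_mul_p, ← F'.u_mul_p i, mul_assoc, hp'p, mul_zero, add_zero]
  have h1 : F.p * (F.p + F'.p) = F.p + F'.p := (hF hFG).1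
  rw [mul_add, F.p_mul_p, hpp'] at h1
  exact (add_left_cancel h1).symm

end Frame

end Splitting

section Pieces

open ContinuousLinearMap

variable {H : Type} [NormedAddCommGroup H] [InnerProductSpace ℂ H] [CompleteSpace H]

/-- A realization of the reduction of `M` by the projection `q` as `k × k` matrices over an abelian
von Neumann algebra `B`, implemented by isometries `V i` with orthogonal ranges summing to `q`. -/
structure MatrixCorner (M : VonNeumannAlgebra H) (k : ℕ) (q : H →L[ℂ] H) where
  K : Type
  [instK : NormedAddCommGroup K]
  [instK2 : InnerProductSpace ℂ K]
  [instK3 : CompleteSpace K]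
  B : VonNeumannAlgebra K
  comm : ∀ x ∈ B, ∀ y ∈ B, x * y = y * x
  V : Fin k → K →L[ℂ] H
  orth : ∀ i j, (V i).adjoint ∘L V j = if i = j then 1 else 0
  lift_mem : ∀ i j, ∀ b ∈ B, V i ∘L b ∘L (V j).adjoint ∈ M
  red_mem : ∀ i j, ∀ x ∈ M, (V i).adjoint ∘L x ∘L V j ∈ B
  sum_eq : ∑ i, V i ∘L (V i).adjoint = q

lemma exists_isometry {p : H →L[ℂ] H} (hp : IsStarProjection p) :
    ∃ (K : Type) (_ : NormedAddCommGroup K) (_ : InnerProductSpace ℂ K) (_ : CompleteSpace K)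
      (ι : K →L[ℂ] H), ι.adjoint ∘L ι = 1 ∧ ι ∘L ι.adjoint = p := by
  obtain ⟨U, hU, rfl⟩ := isStarProjection_iff_eq_starProjection.1 hp
  have hc : IsClosed (U : Set H) := by
    rw [← Submodule.orthogonal_orthogonal U]
    exact Submodule.isClosed_orthogonal _
  have : CompleteSpace U := hc.completeSpace_coe
  refine ⟨U, inferInstance, inferInstance, inferInstance, U.subtypeL, ?_, ?_⟩
  · rw [Submodule.adjoint_subtypeL]
    ext v
    simp
  · rw [Submodule.adjoint_subtypeL]
    rfl

variable {M : VonNeumannAlgebra H} {k : ℕ} {z : H →L[ℂ] H}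

lemma Frame.nonempty_matrixCorner (hno : ∀ G : Frame M (k + 2) z, G.p = 0)
    (F : Frame M (k + 1) z) : Nonempty (MatrixCorner M (k + 1) F.q) := by
  obtain ⟨K, _, _, _, ι, hι, hιp⟩ := exists_isometry F.proj
  have hιM : ι ∘L ι.adjoint ∈ M := hιp ▸ F.p_mem
  have hred : ∀ b ∈ cornerAlgebra M ι hι hιM, b * b = 0 → b = 0 := by
    intro b hb hbb
    refine conjBy_injective hι ?_
    rw [conjBy_zero]
    refine F.reduced_corner hno hb ?_ ?_ ?_
    · rw [← hιp]
      ext v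
      simp [conjBy_apply, adjoint_apply_self hι]
    · rw [← hιp]
      ext v
      simp [conjBy_apply, adjoint_apply_self hι]
    · rw [← conjBy_mul hι, hbb, conjBy_zero]
  have hadj : ∀ i, (F.u i ∘L ι).adjoint = ι.adjoint ∘L star (F.u i) := fun i => by
    rw [adjoint_comp, star_eq_adjoint]
  have horth : ∀ i j, (F.u i ∘L ι).adjoint ∘L (F.u j ∘L ι) = if i = j then 1 else 0 := by
    intro i j
    have : (F.u i ∘L ι).adjoint ∘L (F.u j ∘L ι) = ι.adjoint ∘L (star (F.u i) * F.u j) ∘L ι := by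
      simp only [hadj, mul_def, comp_assoc]
    rw [this, F.star_u_mul_u]
    split_ifs
    · rw [← hιp]
      ext v
      simp [adjoint_apply_self hι]
    · ext v
      simp
  have hlift : ∀ i j, ∀ b ∈ cornerAlgebra M ι hι hιM,
      (F.u i ∘L ι) ∘L b ∘L (F.u j ∘L ι).adjoint ∈ M := by
    intro i j b hb
    have : (F.u i ∘L ι) ∘L b ∘L (F.u j ∘L ι).adjoint
        = F.u i * (conjBy ι b * star (F.u j)) := by
      simp only [hadj, mul_def, conjBy, comp_assoc]
    rw [this]
    exact mul_mem (F.u_mem i) (mul_mem (mem_cornerAlgebra.1 hb) (star_mem (F.u_mem j)))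
  have hredM : ∀ i j, ∀ x ∈ M,
      (F.u i ∘L ι).adjoint ∘L x ∘L (F.u j ∘L ι) ∈ cornerAlgebra M ι hι hιM := by
    intro i j x hx
    have : (F.u i ∘L ι).adjoint ∘L x ∘L (F.u j ∘L ι)
        = ι.adjoint ∘L (star (F.u i) * (x * F.u j)) ∘L ι := by
      simp only [hadj, mul_def, comp_assoc]
    rw [this]
    exact adjoint_comp_mem_cornerAlgebra
      (mul_mem (star_mem (F.u_mem i)) (mul_mem hx (F.u_mem j)))
  have hsum : ∑ i, (F.u i ∘L ι) ∘L (F.u i ∘L ι).adjoint = F.q := by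
    refine Finset.sum_congr rfl fun i _ => ?_
    have : (F.u i ∘L ι) ∘L (F.u i ∘L ι).adjoint
        = F.u i * ((ι ∘L ι.adjoint) * star (F.u i)) := by
      simp only [hadj, mul_def, comp_assoc]
    rw [this, hιp, F.p_mul_star_u]
  exact ⟨⟨K, cornerAlgebra M ι hι hιM, fun x hx y hy => commute_of_reduced hred hx hy,
    fun i => F.u i ∘L ι, horth, hlift, hredM, hsum⟩⟩

/-- If the central projection `z` dominates no nonzero frame of `k + 1` elements, then it is a sum
of central projections whose reductions are matrix algebras of size `1, …, k`. -/
theorem exists_matrixCorner_decomposition (M : VonNeumannAlgebra H) (k : ℕ) :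
    ∀ z ∈ M, IsStarProjection z → (∀ x ∈ M, Commute z x) →
      (∀ G : Frame M (k + 1) z, G.p = 0) →
      ∃ q : ℕ → H →L[ℂ] H, (∀ j < k, Nonempty (MatrixCorner M (j + 1) (q j))) ∧
        (∀ j < k, ∀ x ∈ M, Commute (q j) x) ∧ (∀ j < k, z * q j = q j) ∧
        (∑ j ∈ Finset.range k, q j = z) ∧ ∀ i < k, ∀ j < k, i ≠ j → q i * q j = 0 := by
  induction k with
  | zero =>
    intro z hzM hz _ hno
    refine ⟨fun _ => 0, by simp, by simp, by simp, ?_, by simp⟩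
    have := hno ⟨fun _ => z, z, fun _ => hzM, hzM, hz, fun i j => ?_, fun _ => hz.isIdempotentElem⟩
    · simpa using this.symm
    · rw [if_pos (by omega), hz.isSelfAdjoint.star_eq, hz.isIdempotentElem.eq]
  | succ k ih =>
    intro z hzM hz hzc hno
    obtain ⟨F, hF⟩ := Frame.exists_isMax M (k + 1) z
    have hqc : ∀ x ∈ M, Commute F.q x := fun x hx => F.q_central hno hzc hx
    have hqz : F.q * z = F.q := by rw [(hqc z hzM).eq, F.z_mul_q]
    have hqp : IsStarProjection F.q := ⟨F.q_mul_q, F.star_q⟩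
    obtain ⟨q, hq1, hq2, hq3, hq4, hq5⟩ := ih (z - F.q) (sub_mem hzM F.q_mem)
      (hqp.sub_of_mul_eq_left hz hqz) (fun x hx => (hzc x hx).sub_left (hqc x hx))
      (Frame.eq_zero_of_isMax hF hz.isIdempotentElem hqc hqz)
    have hFq : ∀ j < k, F.q * q j = 0 := fun j hj => by
      rw [← hq3 j hj, ← mul_assoc, mul_sub, hqz, F.q_mul_q, sub_self, zero_mul]
    have hqF : ∀ j < k, q j * F.q = 0 := fun j hj => by
      rw [(hq2 j hj _ F.q_mem).eq, hFq j hj]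
    have hlt : ∀ j < k + 1, j = k ∨ (j < k ∧ j ≠ k) := by omega
    refine ⟨Function.update q k F.q, fun j hj => ?_, fun j hj => ?_, fun j hj => ?_, ?_,
      fun i hi j hj hij => ?_⟩
    · rcases hlt j hj with rfl | ⟨hj, hjk⟩
      · rw [Function.update_self]
        exact F.nonempty_matrixCorner hno
      · rw [Function.update_of_ne hjk]
        exact hq1 j hj
    · rcases hlt j hj with rfl | ⟨hj, hjk⟩
      · rwa [Function.update_self]
      · rw [Function.update_of_ne hjk]
        exact hq2 j hj
    · rcases hlt j hj with rfl | ⟨hj, hjk⟩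
      · rw [Function.update_self, F.z_mul_q]
      · rw [Function.update_of_ne hjk, ← hq3 j hj, ← mul_assoc, mul_sub, hz.isIdempotentElem.eq,
          F.z_mul_q]
    · rw [Finset.sum_range_succ, Function.update_self, ← eq_sub_iff_add_eq, ← hq4]
      refine Finset.sum_congr rfl fun j hj => ?_
      rw [Function.update_of_ne (Finset.mem_range.1 hj).ne]
    · rcases hlt i hi with rfl | ⟨hi, hik⟩
      · rcases hlt j hj with rfl | ⟨hj, hjk⟩
        · exact absurd rfl hij
        · rw [Function.update_self, Function.update_of_ne hjk, hFq j hj]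
      · rcases hlt j hj with rfl | ⟨hj, hjk⟩
        · rw [Function.update_self, Function.update_of_ne hik, hqF i hi]
        · rw [Function.update_of_ne hik, Function.update_of_ne hjk, hq5 i hi j hj hij]

end Pieces

section Assembly

open ContinuousLinearMap

variable {H : Type} [NormedAddCommGroup H] [InnerProductSpace ℂ H] [CompleteSpace H]

namespace MatrixCorner

attribute [instance] MatrixCorner.instK MatrixCorner.instK2 MatrixCorner.instK3

variable {M : VonNeumannAlgebra H} {k k' : ℕ} {q q' : H →L[ℂ] H}

lemma adjoint_V_V_apply (C : MatrixCorner M k q) (i j : Fin k) (v : C.K) :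
    (C.V i).adjoint (C.V j v) = if i = j then v else 0 := by
  have := congrArg (fun T : C.K →L[ℂ] C.K => T v) (C.orth i j)
  split_ifs with h
  · simpa [h] using this
  · simpa [h] using this

lemma q_apply (C : MatrixCorner M k q) (v : H) : q v = ∑ i, C.V i ((C.V i).adjoint v) := by
  conv_lhs => rw [← C.sum_eq]
  rw [sum_apply]
  rfl

lemma q_V_apply (C : MatrixCorner M k q) (i : Fin k) (v : C.K) : q (C.V i v) = C.V i v := by
  simp [C.q_apply, C.adjoint_V_V_apply, apply_ite]

lemma adjoint_V_q_apply (C : MatrixCorner M k q) (i : Fin k) (v : H) :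
    (C.V i).adjoint (q v) = (C.V i).adjoint v := by
  simp [C.q_apply, C.adjoint_V_V_apply]

/-- Compression of `M` to matrices over `B`. -/
def reduce (C : MatrixCorner M k q) :
    M.toStarSubalgebra →+ Matrix (Fin k) (Fin k) C.B.toStarSubalgebra where
  toFun x := Matrix.of fun i j => ⟨(C.V i).adjoint ∘L x.1 ∘L C.V j, C.red_mem i j x.1 x.2⟩
  map_zero' := by
    ext i j v
    simp
  map_add' x y := by
    ext i j v
    simp

lemma reduce_apply (C : MatrixCorner M k q) (x : M.toStarSubalgebra) (i j : Fin k) (v : C.K) :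
    (C.reduce x i j).1 v = (C.V i).adjoint (x.1 (C.V j v)) := rfl

lemma reduce_smul (C : MatrixCorner M k q) (r : ℂ) (x : M.toStarSubalgebra) :
    C.reduce (r • x) = r • C.reduce x := by
  ext i j v
  simp [reduce_apply]

lemma reduce_star (C : MatrixCorner M k q) (x : M.toStarSubalgebra) :
    C.reduce (star x) = star (C.reduce x) := by
  refine Matrix.ext fun i j => Subtype.ext ?_
  change (C.V i).adjoint ∘L star x.1 ∘L C.V j = star ((C.V j).adjoint ∘L x.1 ∘L C.V i)
  simp only [star_eq_adjoint, adjoint_comp, adjoint_adjoint, comp_assoc]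

lemma reduce_mul (C : MatrixCorner M k q) (hq : ∀ x ∈ M, Commute q x)
    (x y : M.toStarSubalgebra) : C.reduce (x * y) = C.reduce x * C.reduce y := by
  ext i j v
  have h1 : y.1 (C.V j v) = q (y.1 (C.V j v)) := by
    conv_lhs => rw [← C.q_V_apply]
    exact congrArg (fun T : H →L[ℂ] H => T (C.V j v)) (hq _ y.2).eq.symm
  have h2 : ((C.reduce x * C.reduce y) i j).1 v
      = ∑ l, (C.reduce x i l).1 ((C.reduce y l j).1 v) := by
    rw [Matrix.mul_apply]
    simp [sum_apply]
  rw [h2, reduce_apply]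
  change (C.V i).adjoint (x.1 (y.1 (C.V j v))) = _
  rw [h1, C.q_apply, map_sum, map_sum]
  rfl

/-- Extension of matrices over `B` to elements of `M`. -/
def lift (C : MatrixCorner M k q) (b : Matrix (Fin k) (Fin k) C.B.toStarSubalgebra) :
    M.toStarSubalgebra :=
  ∑ i, ∑ j, ⟨C.V i ∘L (b i j).1 ∘L (C.V j).adjoint, C.lift_mem i j _ (b i j).2⟩

lemma lift_apply (C : MatrixCorner M k q) (b : Matrix (Fin k) (Fin k) C.B.toStarSubalgebra)
    (v : H) : (C.lift b).1 v = ∑ i, ∑ j, C.V i ((b i j).1 ((C.V j).adjoint v)) := by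
  simp [lift, sum_apply]

lemma lift_reduce_apply (C : MatrixCorner M k q) (x : M.toStarSubalgebra) (v : H) :
    (C.lift (C.reduce x)).1 v = q (x.1 (q v)) := by
  simp [C.lift_apply, C.reduce_apply, C.q_apply, map_sum]

lemma reduce_lift (C : MatrixCorner M k q) (b : Matrix (Fin k) (Fin k) C.B.toStarSubalgebra) :
    C.reduce (C.lift b) = b := by
  ext i j v
  simp [C.lift_apply, C.reduce_apply, C.adjoint_V_V_apply, apply_ite]

lemma reduce_lift_of_mul_eq_zero (C : MatrixCorner M k q) (C' : MatrixCorner M k' q')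
    (h : q * q' = 0) (b : Matrix (Fin k') (Fin k') C'.B.toStarSubalgebra) :
    C.reduce (C'.lift b) = 0 := by
  ext i j v
  have h1 : ∀ l w, (C.V i).adjoint (C'.V l w) = 0 := fun l w => by
    rw [← C'.q_V_apply, ← C.adjoint_V_q_apply, ← mul_apply_eq_comp q q', h]
    simp
  simp [C'.lift_apply, C.reduce_apply, h1]

end MatrixCorner

/-- A finite orthogonal family of central matrix corners with sum `1` identifies `M` with the
product of the corresponding matrix algebras. -/
def matrixCornerEquiv {M : VonNeumannAlgebra H} {ι : Type*} [Fintype ι]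
    {m : ι → ℕ} {q : ι → H →L[ℂ] H} (C : ∀ k, MatrixCorner M (m k) (q k))
    (hc : ∀ k, ∀ x ∈ M, Commute (q k) x) (hs : ∑ k, q k = 1)
    (ho : ∀ k l, k ≠ l → q k * q l = 0) :
    M.toStarSubalgebra ≃⋆ₐ[ℂ] (∀ k, Matrix (Fin (m k)) (Fin (m k)) (C k).B.toStarSubalgebra) where
  toFun x k := (C k).reduce x
  invFun b := ∑ k, (C k).lift (b k)
  left_inv x := by
    ext v
    have hqq : ∀ k, q k * q k = q k := fun k => by
      ext v
      rw [mul_apply_eq_comp, (C k).q_apply v, map_sum]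
      exact Finset.sum_congr rfl fun i _ => (C k).q_V_apply i _
    have h1 : ∀ k, ((C k).lift ((C k).reduce x)).1 v = q k (x.1 v) := fun k => by
      rw [(C k).lift_reduce_apply]
      change (q k * (x.1 * q k)) v = (q k * x.1) v
      rw [← (hc k _ x.2).eq, ← mul_assoc, hqq]
    have h2 : (∑ k, (C k).lift ((C k).reduce x)).1 v
        = ∑ k, ((C k).lift ((C k).reduce x)).1 v := by
      simp [sum_apply]
    rw [h2, Finset.sum_congr rfl fun k _ => h1 k, ← sum_apply, hs]
    rfl
  right_inv b := by
    ext1 k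
    change (C k).reduce (∑ l, (C l).lift (b l)) = b k
    rw [map_sum, Finset.sum_eq_single k, MatrixCorner.reduce_lift]
    · exact fun l _ hl => MatrixCorner.reduce_lift_of_mul_eq_zero _ _ (ho k l hl.symm) _
    · exact fun h => absurd (Finset.mem_univ k) h
  map_mul' x y := funext fun k => (C k).reduce_mul (hc k) x y
  map_add' x y := funext fun k => map_add _ x y
  map_star' x := funext fun k => (C k).reduce_star x
  map_smul' r x := funext fun k => (C k).reduce_smul r x

end Assembly

/-- Every von Neumann algebra `M` that is `n`-subhomogeneous as a
C*-algebra is `*`-isomorphic to a finite product `∏_{k ≤ n} M_k(B_k)` where each `B_k`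
is an abelian von Neumann algebra. -/
theorem stmt9 (n : ℕ) (hn : 1 ≤ n) (H : Type) [NormedAddCommGroup H]
    [InnerProductSpace ℂ H] [CompleteSpace H] (M : VonNeumannAlgebra H)
    (hM : IsSubhomogeneous n M.toStarSubalgebra) :
    Nonempty (SubhomVNDecomposition n M.toStarSubalgebra) := by
  obtain ⟨q, hC, hqc, -, hs, ho⟩ := exists_matrixCorner_decomposition M n 1 (one_mem M)
    (.one _) (fun x _ => Commute.one_left x) fun G => G.p_eq_zero_of_isSubhomogeneous hM
  let C : ∀ k : Fin n, MatrixCorner M (k.1 + 1) (q k) := fun k => (hC k k.2).some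
  exact ⟨{
    K := fun k => (C k).K
    B := fun k => (C k).B
    comm := fun k x y => Subtype.ext ((C k).comm x.1 x.2 y.1 y.2)
    iso := matrixCornerEquiv C (fun k => hqc k k.2) (by rw [Fin.sum_univ_eq_sum_range q, hs])
      fun k l hkl => ho k k.2 l l.2 fun h => hkl (Fin.ext h) }⟩

end
end

section
/- Let F be a finite-dimensional C*-algebra and A a unital C*-algebra. Then every unital completely positive map F → A** can be approximated in the point-ultraweak topology by unital completely positive maps F → A. -/
noncomputable section

/-- An element of a `*`-ring is positive if it is of the form `star b * b`.
(In a C*-algebra this is the usual positivity.) -/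
def IsPosElem {A : Type*} [NonUnitalSemiring A] [StarRing A] (a : A) : Prop :=
  ∃ b, a = star b * b

/-- A linear map `φ : A → B` between `*`-algebras is `k`-positive if
`φ ⊗ id_{M_k} : M_k(A) → M_k(B)` (i.e. the entrywise application of `φ`)
maps positive elements to positive elements. -/
def KPositive {A B : Type*} [NonUnitalRing A] [StarRing A] [Module ℂ A]
    [NonUnitalRing B] [StarRing B] [Module ℂ B] (k : ℕ) (φ : A →ₗ[ℂ] B) : Prop :=
  ∀ x : Matrix (Fin k) (Fin k) A, IsPosElem x → IsPosElem (x.map φ)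

/-- A linear map is completely positive if it is `k`-positive for all `k`. -/
def CompletelyPositive {A B : Type*} [NonUnitalRing A] [StarRing A] [Module ℂ A]
    [NonUnitalRing B] [StarRing B] [Module ℂ B] (φ : A →ₗ[ℂ] B) : Prop :=
  ∀ k : ℕ, KPositive k φ

section Frame

open scoped ComplexOrder

variable {F : Type*} [CStarAlgebra F]

lemma nonneg_of_mem_spectrum_star_mul_self {x : F} {μ : ℂ} (hμ : μ ∈ spectrum ℂ (star x * x)) :
    0 ≤ μ := by
  have h := (IsSelfAdjoint.star_mul_self x).mem_spectrum_eq_re hμ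
  rw [h] at hμ ⊢
  have := spectrum_star_mul_self_nonneg (b := x) _
    ((spectrum.algebraMap_mem_iff (S := ℂ) (R := ℝ)).1 hμ)
  exact_mod_cast this

lemma nonneg_of_mem_roots_charpoly_mulLeft [FiniteDimensional ℂ F] {x : F} {μ : ℂ}
    (hμ : μ ∈ (LinearMap.mulLeft ℂ (star x * x)).charpoly.roots) : 0 ≤ μ := by
  have h := (Module.End.hasEigenvalue_iff_isRoot_charpoly _ μ).2
    (Polynomial.isRoot_of_mem_roots hμ)
  obtain ⟨v, hv⟩ := h.exists_hasEigenvector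
  refine nonneg_of_mem_spectrum_star_mul_self (x := x) ?_
  rw [spectrum.mem_iff]
  intro hu
  apply hv.2
  have h1 := hv.apply_eq_smul
  rw [LinearMap.mulLeft_apply] at h1
  refine (hu.mul_right_eq_zero (b := v)).1 ?_
  rw [sub_mul, h1, Algebra.algebraMap_eq_smul_one, smul_mul_assoc, one_mul, sub_self]

variable (F) in
/-- The trace of the left regular representation of `F`. -/
def regularTrace : F →ₗ[ℂ] ℂ := LinearMap.trace ℂ F ∘ₗ LinearMap.mul ℂ F

lemma regularTrace_apply (x : F) :
    regularTrace F x = LinearMap.trace ℂ F (LinearMap.mulLeft ℂ x) := rfl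

lemma regularTrace_mul_comm (x y : F) : regularTrace F (x * y) = regularTrace F (y * x) := by
  simp only [regularTrace_apply, LinearMap.mulLeft_mul]
  exact LinearMap.trace_mul_comm _ _ _

variable [FiniteDimensional ℂ F]

lemma regularTrace_one : regularTrace F 1 = (Module.finrank ℂ F : ℂ) := by
  rw [regularTrace_apply, LinearMap.mulLeft_one, LinearMap.trace_id]

lemma regularTrace_star_mul_self_nonneg (x : F) : 0 ≤ regularTrace F (star x * x) := by
  rw [regularTrace_apply,
    Module.End.trace_eq_sum_roots_charpoly_of_splits (IsAlgClosed.splits _)]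
  exact Multiset.sum_nonneg fun μ hμ => nonneg_of_mem_roots_charpoly_mulLeft hμ

lemma eq_zero_of_regularTrace_star_mul_self {x : F} (h : regularTrace F (star x * x) = 0) :
    x = 0 := by
  rw [regularTrace_apply,
    Module.End.trace_eq_sum_roots_charpoly_of_splits (IsAlgClosed.splits _)] at h
  have h0 : ∀ μ ∈ (LinearMap.mulLeft ℂ (star x * x)).charpoly.roots, μ = 0 :=
    fun μ hμ => Multiset.all_zero_of_le_zero_le_of_sum_eq_zero
      (fun _ hμ => nonneg_of_mem_roots_charpoly_mulLeft hμ) h μ hμ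
  have hr := Multiset.eq_replicate_card.2 h0
  have hs := IsAlgClosed.splits (LinearMap.mulLeft ℂ (star x * x)).charpoly
  have hc := hs.eq_prod_roots_of_monic (LinearMap.charpoly_monic _)
  rw [hr] at hc
  have hn : IsNilpotent (LinearMap.mulLeft ℂ (star x * x)) := by
    refine ⟨Multiset.card (LinearMap.mulLeft ℂ (star x * x)).charpoly.roots, ?_⟩
    have := LinearMap.aeval_self_charpoly (LinearMap.mulLeft ℂ (star x * x))
    rw [hc] at this
    simpa using this
  obtain ⟨n, hn⟩ := hn
  have hn1 : (star x * x) ^ n = 0 := by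
    rw [LinearMap.pow_mulLeft] at hn
    simpa using congrArg (fun f => f 1) hn
  rw [← CStarRing.star_mul_self_eq_zero_iff]
  have hsa := IsSelfAdjoint.star_mul_self x
  have hp : ∀ k : ℕ, (star x * x) ^ (2 ^ k) = 0 → star x * x = 0 := fun k hk => by
    have := hsa.nnnorm_pow_two_pow k
    rw [hk, nnnorm_zero, eq_comm] at this
    exact nnnorm_eq_zero.1 (pow_eq_zero_iff (by positivity) |>.1 this)
  exact hp n (pow_eq_zero_of_le Nat.lt_two_pow_self.le hn1)

lemma regularTrace_star (x : F) : regularTrace F (star x) = star (regularTrace F x) := by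
  set T := regularTrace F
  have key : ∀ y : F, star (T (star y * y)) = T (star y * y) := fun y =>
    (IsSelfAdjoint.of_nonneg (regularTrace_star_mul_self_nonneg y)).star_eq
  have h1 := key (x + 1)
  have h2 := key (x + Complex.I • 1)
  have h3 := key x
  have h4 := key 1
  simp only [star_add, star_one, star_smul, mul_add, add_mul, mul_one, one_mul, map_add,
    smul_mul_assoc, mul_smul_comm, map_smul, smul_eq_mul, star_mul', h3] at h1 h2 h4
  simp only [Complex.star_def, Complex.conj_I, map_neg] at h1 h2 h4 ⊢
  rw [h4] at h1 h2
  linear_combination (1 / 2 : ℂ) * (-h1) + (Complex.I / 2) * h2 +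
    (-(1 / 2) * ((starRingEnd ℂ) (T x) - (starRingEnd ℂ) (T (star x)) + T x - T (star x))) *
      Complex.I_sq

lemma exists_basis_core_inner {V : Type*} [AddCommGroup V] [Module ℂ V] [FiniteDimensional ℂ V]
    (c : InnerProductSpace.Core ℂ V) :
    ∃ (n : ℕ) (b : Module.Basis (Fin n) ℂ V), ∀ i x, b.repr x i = c.inner (b i) x := by
  let _ := c.toNormedAddCommGroup
  let _ : InnerProductSpace ℂ V := .ofCore c.toCore
  refine ⟨_, (stdOrthonormalBasis ℂ V).toBasis, fun i x => ?_⟩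
  simp only [OrthonormalBasis.coe_toBasis, OrthonormalBasis.coe_toBasis_repr_apply,
    OrthonormalBasis.repr_apply_apply]

variable (F) in
/-- An orthonormal basis `y` of `F` for the inner product `⟨a, b⟩ = regularTrace F (a* b)`
satisfies `∑ i, yᵢ yᵢ* = 1`. -/
lemma exists_trace_orthonormal_basis : ∃ (n : ℕ) (y : Fin n → F),
    (∀ x, x = ∑ i, regularTrace F (star (y i) * x) • y i) ∧ ∑ i, y i * star (y i) = 1 := by
  let c : InnerProductSpace.Core ℂ F :=
    { inner := fun a b => regularTrace F (star a * b)
      conj_inner_symm := fun a b => by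
        rw [← Complex.star_def, ← regularTrace_star]; simp
      re_inner_nonneg := fun a => (Complex.nonneg_iff.1 (regularTrace_star_mul_self_nonneg a)).1
      add_left := fun a b d => by simp [add_mul]
      smul_left := fun a b r => by simp
      definite := fun a h => eq_zero_of_regularTrace_star_mul_self h }
  obtain ⟨n, b, hb⟩ := exists_basis_core_inner c
  have hb' : ∀ i x, b.repr x i = regularTrace F (star (b i) * x) := hb
  refine ⟨n, b, fun x => ?_, ?_⟩
  · simp only [← hb']
    exact (b.sum_repr x).symm
  · have key : ∀ x, regularTrace F (x * ∑ i, b i * star (b i)) = regularTrace F x := by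
      intro x
      rw [Finset.mul_sum, map_sum, regularTrace_apply x, LinearMap.trace_eq_matrix_trace ℂ b,
        Matrix.trace]
      refine Finset.sum_congr rfl fun i _ => ?_
      rw [Matrix.diag_apply, LinearMap.toMatrix_apply, hb', ← mul_assoc, regularTrace_mul_comm,
        LinearMap.mulLeft_apply]
    rw [← sub_eq_zero]
    apply eq_zero_of_regularTrace_star_mul_self
    rw [mul_sub, map_sub, key, mul_one, sub_self]

end Frame

lemma isPosElem_iff_nonneg {B : Type*} [CStarAlgebra B] [PartialOrder B] [StarOrderedRing B]
    {a : B} : IsPosElem a ↔ 0 ≤ a :=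
  CStarAlgebra.nonneg_iff_eq_star_mul_self.symm

lemma IsPosElem.isSelfAdjoint {A : Type*} [NonUnitalSemiring A] [StarRing A] {a : A}
    (ha : IsPosElem a) : IsSelfAdjoint a := by
  obtain ⟨e, rfl⟩ := ha
  exact IsSelfAdjoint.star_mul_self e

lemma IsPosElem.sum {B R : Type*} [CStarAlgebra B] (s : Finset R) {a : R → B}
    (ha : ∀ r ∈ s, IsPosElem (a r)) : IsPosElem (∑ r ∈ s, a r) := by
  let _ := CStarAlgebra.spectralOrder B
  have _ := CStarAlgebra.spectralOrderedRing B
  simp only [isPosElem_iff_nonneg] at ha ⊢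
  exact Finset.sum_nonneg ha

lemma IsPosElem.exists_commuting_factor {B : Type*} [CStarAlgebra B] {a : B} (ha : IsPosElem a) :
    ∃ b, a = star b * b ∧ ∀ d, Commute a d → Commute b d := by
  let _ := CStarAlgebra.spectralOrder B
  have _ := CStarAlgebra.spectralOrderedRing B
  refine ⟨CFC.sqrt a, ?_, fun d hd => ?_⟩
  · rw [(IsSelfAdjoint.of_nonneg (CFC.sqrt_nonneg a)).star_eq,
      CFC.sqrt_mul_sqrt_self a (isPosElem_iff_nonneg.1 ha)]
  · rw [CFC.sqrt_eq_cfc]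
    exact hd.cfc_nnreal _

lemma isPosElem_of_star_mul {B : Type*} [Ring B] [StarRing B] {k : ℕ} (c : Fin k → B) :
    IsPosElem (Matrix.of fun p q => star (c p) * c q) := by
  cases k with
  | zero => exact ⟨0, Subsingleton.elim _ _⟩
  | succ k =>
    refine ⟨Matrix.of fun r p => if r = 0 then c p else 0, ?_⟩
    ext p q
    simp [Matrix.mul_apply, Matrix.star_apply]

lemma isPosElem_sum_star_mul {B : Type*} [CStarAlgebra B] {k : ℕ} {R : Type*} [Fintype R]
    (c : R → Fin k → B) : IsPosElem (Matrix.of fun p q => ∑ r, star (c r p) * c r q) := by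
  let _ := CStarAlgebra.spectralOrder B
  have _ := CStarAlgebra.spectralOrderedRing B
  have h : IsPosElem (∑ r, Matrix.of fun p q => star (c r p) * c r q) :=
    IsPosElem.sum (B := CStarMatrix (Fin k) (Fin k) B) Finset.univ
      fun r _ => isPosElem_of_star_mul (c r)
  convert h using 1
  ext p q
  simp [Matrix.sum_apply]

lemma exists_centralizer_factorization {B : Type*} [CStarAlgebra B] {n : ℕ} {T : Set B}
    {M : Matrix (Fin n) (Fin n) B} (hM : IsPosElem M) (hT : ∀ i j, M i j ∈ T.centralizer) :
    ∃ D : Fin n → Fin n → B, (∀ l i, D l i ∈ T.centralizer) ∧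
      ∀ i j, M i j = ∑ l, star (D l i) * D l j := by
  let _ := CStarAlgebra.spectralOrder B
  have _ := CStarAlgebra.spectralOrderedRing B
  have h : ∃ D : Matrix (Fin n) (Fin n) B, M = star D * D ∧ ∀ d, Commute M d → Commute D d :=
    IsPosElem.exists_commuting_factor (B := CStarMatrix (Fin n) (Fin n) B) hM
  obtain ⟨D, hMD, hD⟩ := h
  refine ⟨D, fun l i => Set.mem_centralizer_iff.2 fun t ht => ?_, fun i j => ?_⟩
  · have hd : Commute M (Matrix.diagonal fun _ => t) := by
      ext p q
      rw [Matrix.mul_diagonal, Matrix.diagonal_mul]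
      exact (Set.mem_centralizer_iff.1 (hT p q) t ht).symm
    have h1 := congrFun (congrFun (hD _ hd).eq l) i
    rw [Matrix.mul_diagonal, Matrix.diagonal_mul] at h1
    exact h1.symm
  · rw [hMD]
    simp [Matrix.mul_apply, Matrix.star_apply]

section KernelMap

variable {F B : Type*} [CStarAlgebra F] [CStarAlgebra B] {n : ℕ}

/-- The map `x ↦ ∑ l i j, τ (yᵢ* x yⱼ) • (D l i)* (D l j)`. -/
def kernelMap {κ : Type*} [Fintype κ] (τ : F →ₗ[ℂ] ℂ) (y : Fin n → F) (D : κ → Fin n → B) :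
    F →ₗ[ℂ] B :=
  ∑ l, ∑ i, ∑ j, (τ ∘ₗ LinearMap.mulLeft ℂ (star (y i)) ∘ₗ LinearMap.mulRight ℂ (y j)).smulRight
    (star (D l i) * D l j)

variable {κ κ' : Type*} [Fintype κ] [Fintype κ'] {τ : F →ₗ[ℂ] ℂ} {y : Fin n → F}

lemma kernelMap_apply (D : κ → Fin n → B) (x : F) :
    kernelMap τ y D x = ∑ l, ∑ i, ∑ j, τ (star (y i) * (x * y j)) • (star (D l i) * D l j) := by
  simp [kernelMap, LinearMap.sum_apply]

lemma kernelMap_sumElim (D : κ → Fin n → B) (D' : κ' → Fin n → B) :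
    kernelMap τ y (Sum.elim D D') = kernelMap τ y D + kernelMap τ y D' := by
  simp [kernelMap, Fintype.sum_sum_type]

lemma kernelMap_mul_right (D : κ → Fin n → B) (c : B) (x : F) :
    kernelMap τ y (fun l i => D l i * c) x = star c * kernelMap τ y D x * c := by
  simp only [kernelMap_apply, Finset.mul_sum, Finset.sum_mul, star_mul, mul_smul_comm,
    smul_mul_assoc, mul_assoc]

lemma kernelMap_sqrt_smul (D : κ → Fin n → B) {a : ℝ} (ha : 0 ≤ a) :
    kernelMap τ y (fun l i => ((√a : ℝ) : ℂ) • D l i) = (a : ℂ) • kernelMap τ y D := by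
  ext x
  have : ((√a : ℝ) : ℂ) * ((√a : ℝ) : ℂ) = a := by
    rw [← Complex.ofReal_mul, Real.mul_self_sqrt ha]
  simp only [kernelMap_apply, LinearMap.smul_apply, Finset.smul_sum, star_smul, mul_smul_comm,
    smul_mul_assoc, Complex.star_def, Complex.conj_ofReal]
  simp only [smul_smul, this]
  simp only [mul_comm (a : ℂ)]

lemma kernelMap_mem {D : κ → Fin n → B} {S : StarSubalgebra ℂ B} (hD : ∀ l i, D l i ∈ S) (x : F) :
    kernelMap τ y D x ∈ S := by
  rw [kernelMap_apply]
  exact sum_mem fun l _ => sum_mem fun i _ => sum_mem fun j _ =>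
    S.smul_mem (mul_mem (star_mem (hD l i)) (hD l j)) _

lemma kernelMap_diagonal (hy : ∑ i, y i * star (y i) = 1) (hτ : ∀ a b, τ (a * b) = τ (b * a))
    (g : B) (x : F) :
    kernelMap τ y (fun l i => if l = i then g else 0) x = τ x • (star g * g) := by
  rw [kernelMap_apply]
  have : ∀ l : Fin n, ∑ i, ∑ j, τ (star (y i) * (x * y j)) •
      (star (if l = i then g else 0) * (if l = j then g else 0)) =
      τ (x * (y l * star (y l))) • (star g * g) := by
    intro l
    rw [Finset.sum_eq_single l (by intro i _ hi; simp [hi.symm]) (by simp),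
      Finset.sum_eq_single l (by intro i _ hi; simp [hi.symm]) (by simp), hτ]
    simp [mul_assoc]
  rw [Finset.sum_congr rfl fun l _ => this l, ← Finset.sum_smul, ← map_sum, ← Finset.mul_sum, hy,
    mul_one]

lemma completelyPositive_kernelMap (hy : ∀ x, x = ∑ i, τ (star (y i) * x) • y i)
    (hτ : ∀ x, τ (star x) = star (τ x)) (D : κ → Fin n → B) :
    CompletelyPositive (kernelMap τ y D) := by
  have parseval : ∀ a b, τ (star a * b) = ∑ m, star (τ (star (y m) * a)) * τ (star (y m) * b) := by
    intro a b
    conv_lhs => rw [hy b]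
    simp only [Finset.mul_sum, map_sum, mul_smul_comm, map_smul, smul_eq_mul]
    refine Finset.sum_congr rfl fun m _ => ?_
    rw [← hτ, star_mul, star_star, mul_comm]
  rintro k _ ⟨b, rfl⟩
  convert isPosElem_sum_star_mul (R := Fin k × Fin n × κ) (fun r p =>
    ∑ i, τ (star (y r.2.1) * (b r.1 p * y i)) • D r.2.2 i) using 1
  ext1 p q
  simp only [Matrix.map_apply, Matrix.of_apply, kernelMap_apply, Matrix.mul_apply,
    Matrix.star_apply, Fintype.sum_prod_type, star_sum, star_smul, Finset.sum_mul, Finset.mul_sum,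
    map_sum, smul_mul_smul_comm]
  have expand : ∀ (r : Fin k) (i j : Fin n), τ (star (y i) * (star (b r p) * b r q * y j)) =
      ∑ m, star (τ (star (y m) * (b r p * y i))) * τ (star (y m) * (b r q * y j)) := by
    intro r i j
    rw [← parseval, star_mul]
    simp only [mul_assoc]
  simp only [expand, Finset.sum_smul]
  refine Finset.sum_congr rfl fun r _ => ?_
  rw [Finset.sum_comm (s := (Finset.univ : Finset (Fin n))) (t := (Finset.univ : Finset κ))]
  refine Finset.sum_congr rfl fun l _ => ?_
  rw [Finset.sum_congr rfl fun m _ => Finset.sum_comm, Finset.sum_comm]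
  refine Finset.sum_congr rfl fun i _ => ?_
  rw [Finset.sum_comm]

end KernelMap

section Density

variable {H : Type*} [NormedAddCommGroup H] [InnerProductSpace ℂ H] [CompleteSpace H]

/-- A form of the double commutant theorem: an element of `S''` can be approximated by elements
of `S` on finitely many vectors. -/
lemma mem_closure_of_mem_centralizer_centralizer {ι : Type*} [Fintype ι]
    (S : StarSubalgebra ℂ (H →L[ℂ] H)) {T : H →L[ℂ] H}
    (hT : T ∈ (S : Set (H →L[ℂ] H)).centralizer.centralizer) (v : ι → H) :
    (fun i => T (v i)) ∈ closure ((fun a : H →L[ℂ] H => fun i => a (v i)) '' S) := by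
  classical
  let δ : (H →L[ℂ] H) → (PiLp 2 fun _ : ι => H) → PiLp 2 fun _ : ι => H := fun a x =>
    WithLp.toLp 2 fun i => a (x i)
  have δ_cont : ∀ a, Continuous (δ a) := fun a =>
    (PiLp.continuous_toLp 2 _).comp (continuous_pi fun i =>
      a.continuous.comp ((continuous_apply i).comp (PiLp.continuous_ofLp 2 _)))
  let L : (H →L[ℂ] H) →ₗ[ℂ] PiLp 2 fun _ : ι => H :=
    { toFun := fun a => δ a (WithLp.toLp 2 v)
      map_add' := fun a b => by ext i; simp [δ]
      map_smul' := fun c a => by ext i; simp [δ] }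
  let K := ((Subalgebra.toSubmodule S.toSubalgebra).map L).topologicalClosure
  have : CompleteSpace K := (Submodule.isClosed_topologicalClosure _).completeSpace_coe
  have hK : ∀ s ∈ S, ∀ x ∈ K, δ s x ∈ K := by
    intro s hs x hx
    refine map_mem_closure (δ_cont s) hx ?_
    rintro _ ⟨a, ha, rfl⟩
    exact ⟨s * a, S.mul_mem hs ha, rfl⟩
  have hKo : ∀ s ∈ S, ∀ x ∈ Kᗮ, δ s x ∈ Kᗮ := by
    intro s hs x hx
    rw [Submodule.mem_orthogonal] at hx ⊢
    intro u hu
    have := hx _ (hK _ (star_mem hs) u hu)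
    simpa only [δ, PiLp.inner_apply, ContinuousLinearMap.star_eq_adjoint,
      ContinuousLinearMap.adjoint_inner_left] using this
  have hP : ∀ s ∈ S, ∀ x, K.starProjection (δ s x) = δ s (K.starProjection x) := by
    intro s hs x
    refine Submodule.eq_starProjection_of_mem_orthogonal
      (hK s hs _ (K.starProjection_apply_mem x)) ?_
    have h1 := hKo s hs _ (K.sub_starProjection_mem_orthogonal x)
    convert h1 using 1
    ext i
    simp [δ]
  let p : ι → ι → H →L[ℂ] H := fun i j =>
    (PiLp.proj 2 (fun _ : ι => H) i : (PiLp 2 fun _ : ι => H) →L[ℂ] H) ∘L K.starProjection ∘L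
      (PiLp.continuousLinearEquiv 2 ℂ (fun _ : ι => H)).symm.toContinuousLinearMap ∘L
      ContinuousLinearMap.single ℂ (fun _ : ι => H) j
  have p_apply : ∀ i j h, p i j h = K.starProjection (WithLp.toLp 2 (Pi.single j h)) i :=
    fun i j h => rfl
  have hp : ∀ i j, p i j ∈ (S : Set (H →L[ℂ] H)).centralizer := by
    intro i j
    rw [Set.mem_centralizer_iff]
    intro s hs
    ext h
    rw [mul_apply_eq_comp, mul_apply_eq_comp, p_apply, p_apply]
    have h1 := congrArg (fun z : PiLp 2 fun _ : ι => H => z i)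
      (hP s hs (WithLp.toLp 2 (Pi.single j h)))
    have h2 : δ s (WithLp.toLp 2 (Pi.single j h)) = WithLp.toLp 2 (Pi.single j (s h)) := by
      ext k
      by_cases hk : k = j
      · subst hk; simp [δ]
      · simp [δ, hk]
    rw [h2] at h1
    exact h1.symm
  have sum_p : ∀ (x : PiLp 2 fun _ : ι => H) i, K.starProjection x i = ∑ j, p i j (x j) := by
    intro x i
    have hx : x = ∑ j, (WithLp.toLp 2 (Pi.single j (x j)) : PiLp 2 fun _ : ι => H) := by
      ext k
      simp [Finset.sum_apply, Pi.single_apply]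
    conv_lhs => rw [hx]
    rw [map_sum, WithLp.ofLp_sum, Finset.sum_apply]
    rfl
  have hv : WithLp.toLp 2 v ∈ K := by
    refine subset_closure ⟨1, one_mem S, ?_⟩
    ext i
    simp [L, δ]
  have hTv : L T ∈ K := by
    rw [← Submodule.starProjection_eq_self_iff] at hv ⊢
    ext i
    rw [sum_p]
    have h1 := congrArg (fun z : PiLp 2 fun _ : ι => H => T (z i)) hv
    simp only [sum_p, map_sum] at h1
    refine Eq.trans (Finset.sum_congr rfl fun j _ => ?_) h1
    exact DFunLike.congr_fun (Set.mem_centralizer_iff.1 hT _ (hp i j)) (v j)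
  have := map_mem_closure (PiLp.continuous_ofLp 2 (fun _ : ι => H)) hTv
    (t := (fun a : H →L[ℂ] H => fun i => a (v i)) '' S) (by
      rintro _ ⟨a, ha, rfl⟩
      exact ⟨a, ha, rfl⟩)
  exact this

end Density

section Approximation

variable {F : Type*} [CStarAlgebra F] {H : Type*} [NormedAddCommGroup H] [InnerProductSpace ℂ H]
  [CompleteSpace H] {n : ℕ} {τ : F →ₗ[ℂ] ℂ} {y : Fin n → F}

lemma CompletelyPositive.exists_eq_kernelMap {B : Type*} [CStarAlgebra B] {T : Set B}
    (hy : ∀ x, x = ∑ i, τ (star (y i) * x) • y i) (hy1 : ∑ i, y i * star (y i) = 1)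
    {φ : F →ₗ[ℂ] B} (hφ : CompletelyPositive φ) (hT : ∀ x, φ x ∈ T.centralizer) :
    ∃ D : Fin n → Fin n → B, (∀ l i, D l i ∈ T.centralizer) ∧ φ = kernelMap τ y D := by
  obtain ⟨D, hD, hφD⟩ := exists_centralizer_factorization (T := T)
    (hφ n _ (isPosElem_of_star_mul fun i => star (y i))) (fun i j => hT _)
  refine ⟨D, hD, LinearMap.ext fun x => ?_⟩
  have hx : x = ∑ i, ∑ j, τ (star (y i) * (x * y j)) • (y i * star (y j)) := by
    conv_lhs => rw [← mul_one x, ← hy1, Finset.mul_sum]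
    rw [Finset.sum_comm]
    refine Finset.sum_congr rfl fun j _ => ?_
    conv_lhs => rw [← mul_assoc, hy (x * y j), Finset.sum_mul]
    simp only [smul_mul_assoc]
  conv_lhs => rw [hx]
  simp only [map_sum, map_smul]
  rw [kernelMap_apply]
  conv_rhs => rw [Finset.sum_comm]
  refine Finset.sum_congr rfl fun i _ => ?_
  conv_rhs => rw [Finset.sum_comm]
  refine Finset.sum_congr rfl fun j _ => ?_
  rw [← Finset.smul_sum, ← hφD i j]
  simp

variable {ι : Type*} [Fintype ι] (S : StarSubalgebra ℂ (H →L[ℂ] H))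

lemma inner_kernelMap {κ : Type*} [Fintype κ] (D : κ → Fin n → H →L[ℂ] H) (x : F) (w v : H) :
    inner ℂ w (kernelMap τ y D x v) =
      ∑ l, ∑ i, ∑ j, τ (star (y i) * (x * y j)) * inner ℂ (D l i w) (D l j v) := by
  simp only [kernelMap_apply, sum_apply, smul_apply,
    inner_sum, inner_smul_right, mul_apply_eq_comp, ContinuousLinearMap.star_eq_adjoint,
    ContinuousLinearMap.adjoint_inner_right]

lemma re_sum_inner_kernelMap_mem_closure {D : Fin n → Fin n → H →L[ℂ] H}
    (hD : ∀ l i, D l i ∈ (S : Set (H →L[ℂ] H)).centralizer.centralizer)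
    (x : ι → F) (v w : ι → H) :
    (∑ a, inner ℂ (w a) (kernelMap τ y D (x a) (v a))).re ∈
      closure {z | ∃ D' : Fin n → Fin n → H →L[ℂ] H, (∀ l i, D' l i ∈ S) ∧
        z = (∑ a, inner ℂ (w a) (kernelMap τ y D' (x a) (v a))).re} := by
  let G : (Fin n × Fin n → ι ⊕ ι → H) → ℝ := fun z =>
    (∑ a, ∑ l, ∑ i, ∑ j, τ (star (y i) * (x a * y j)) *
      inner ℂ (z (l, i) (Sum.inl a)) (z (l, j) (Sum.inr a))).re
  have hG : Continuous G := by fun_prop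
  let ev : (H →L[ℂ] H) → ι ⊕ ι → H := fun a u => a (Sum.elim w v u)
  have hz : (fun li : Fin n × Fin n => ev (D li.1 li.2)) ∈
      closure (Set.univ.pi fun _ : Fin n × Fin n => ev '' S) := by
    rw [closure_pi_set]
    exact fun li _ => mem_closure_of_mem_centralizer_centralizer S (hD li.1 li.2) _
  have := map_mem_closure hG hz (t := {z | ∃ D' : Fin n → Fin n → H →L[ℂ] H,
    (∀ l i, D' l i ∈ S) ∧ z = (∑ a, inner ℂ (w a) (kernelMap τ y D' (x a) (v a))).re}) (by
      intro z hz
      choose D' hD' hzD' using fun li => hz li trivial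
      refine ⟨fun l i => D' (l, i), fun l i => hD' _, ?_⟩
      simp only [inner_kernelMap, G, ← hzD', ev, Sum.elim_inl, Sum.elim_inr])
  simpa only [inner_kernelMap, G, ev, Sum.elim_inl, Sum.elim_inr] using this

lemma exists_kernelMap_near {D : Fin n → Fin n → H →L[ℂ] H}
    (hD : ∀ l i, D l i ∈ (S : Set (H →L[ℂ] H)).centralizer.centralizer)
    (x : ι → F) (v : ι → H) {δ : ℝ} (hδ : 0 < δ) :
    ∃ (κ : Type) (_ : Fintype κ) (D' : κ → Fin n → H →L[ℂ] H), (∀ l i, D' l i ∈ S) ∧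
      ∀ a, ‖kernelMap τ y D (x a) (v a) - kernelMap τ y D' (x a) (v a)‖ < δ := by
  let t : Set (PiLp 2 fun _ : ι => H) := {e | ∃ (κ : Type) (_ : Fintype κ)
    (D' : κ → Fin n → H →L[ℂ] H), (∀ l i, D' l i ∈ S) ∧
      e = WithLp.toLp 2 fun a => kernelMap τ y D' (x a) (v a)}
  have ht : Convex ℝ t := by
    rintro _ ⟨κ₁, _, D₁, hD₁, rfl⟩ _ ⟨κ₂, _, D₂, hD₂, rfl⟩ a b ha hb -
    refine ⟨κ₁ ⊕ κ₂, inferInstance, Sum.elim (fun l i => ((√a : ℝ) : ℂ) • D₁ l i)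
      (fun l i => ((√b : ℝ) : ℂ) • D₂ l i), ?_, ?_⟩
    · rintro (l | l) i
      · exact S.smul_mem (hD₁ l i) _
      · exact S.smul_mem (hD₂ l i) _
    · rw [kernelMap_sumElim, kernelMap_sqrt_smul _ ha, kernelMap_sqrt_smul _ hb]
      ext i
      simp
  have hmem : (WithLp.toLp 2 fun a => kernelMap τ y D (x a) (v a) : PiLp 2 fun _ : ι => H) ∈
      closure t := by
    by_contra hnot
    obtain ⟨f, u, hfu, huf⟩ := RCLike.geometric_hahn_banach_point_closed (𝕜 := ℂ) ht.closure
      isClosed_closure hnot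
    set w := (InnerProductSpace.toDual ℂ (PiLp 2 fun _ : ι => H)).symm f with hw
    have hf : ∀ e, f e = ∑ a, inner ℂ (w a) (e a) := fun e => by
      rw [← PiLp.inner_apply, hw, InnerProductSpace.toDual_symm_apply]
    have h1 := re_sum_inner_kernelMap_mem_closure (τ := τ) (y := y) S hD x v w
    have h2 : closure {z | ∃ D' : Fin n → Fin n → H →L[ℂ] H, (∀ l i, D' l i ∈ S) ∧
        z = (∑ a, inner ℂ (w a) (kernelMap τ y D' (x a) (v a))).re} ⊆ Set.Ici u := by
      refine closure_minimal ?_ isClosed_Ici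
      rintro _ ⟨D', hD', rfl⟩
      have := huf _ (subset_closure ⟨Fin n, inferInstance, D', hD', rfl⟩)
      rw [hf] at this
      exact this.le
    rw [hf] at hfu
    exact absurd (h2 h1) (not_le.2 hfu)
  obtain ⟨_, ⟨κ, hκ, D', hD', rfl⟩, hdist⟩ := Metric.mem_closure_iff.1 hmem δ hδ
  refine ⟨κ, hκ, D', hD', fun a => lt_of_le_of_lt ?_ hdist⟩
  rw [dist_eq_norm]
  exact PiLp.norm_apply_le (p := 2) (β := fun _ : ι => H)
    ((WithLp.toLp 2 fun a => kernelMap τ y D (x a) (v a)) -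
      WithLp.toLp 2 fun a => kernelMap τ y D' (x a) (v a)) a

end Approximation

section Normalization

variable {F : Type*} [CStarAlgebra F] {H : Type*} [NormedAddCommGroup H] [InnerProductSpace ℂ H]
  [CompleteSpace H]

lemma CompletelyPositive.isPosElem_map {B : Type*} [CStarAlgebra B] {ψ : F →ₗ[ℂ] B}
    (hψ : CompletelyPositive ψ) {a : F} (ha : IsPosElem a) : IsPosElem (ψ a) := by
  obtain ⟨e, rfl⟩ := ha
  obtain ⟨E, hE⟩ := hψ 1 _ (isPosElem_of_star_mul fun _ => e)
  refine ⟨E 0 0, ?_⟩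
  have := congrFun (congrFun hE 0) 0
  simpa [Matrix.mul_apply, Matrix.star_apply] using this

lemma IsPosElem.re_inner_nonneg {a : H →L[ℂ] H} (ha : IsPosElem a) (u : H) :
    0 ≤ (inner ℂ u (a u)).re := by
  obtain ⟨e, rfl⟩ := ha
  rw [mul_apply_eq_comp, ContinuousLinearMap.star_eq_adjoint,
    ContinuousLinearMap.adjoint_inner_right]
  exact inner_self_nonneg (𝕜 := ℂ)

/-- The Cauchy–Schwarz inequality for a completely positive map. -/
lemma CompletelyPositive.norm_inner_le {ψ : F →ₗ[ℂ] (H →L[ℂ] H)} (hψ : CompletelyPositive ψ)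
    (x : F) (w u : H) :
    ‖inner ℂ w (ψ x u)‖ ≤ ‖x‖ * √(inner ℂ w (ψ 1 w)).re * √(inner ℂ u (ψ 1 u)).re := by
  obtain ⟨E, hE⟩ := hψ 2 _ (isPosElem_of_star_mul ![star x, 1])
  let P : Fin 2 → H → PiLp 2 fun _ : Fin 2 => H := fun p v => WithLp.toLp 2 fun r => E r p v
  have hP : ∀ p q v v', inner ℂ v (ψ (star (![star x, 1] p) * ![star x, 1] q) v') =
      inner ℂ (P p v) (P q v') := by
    intro p q v v'
    have := congrFun (congrFun hE p) q
    rw [Matrix.map_apply, Matrix.of_apply] at this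
    rw [this]
    simp only [Matrix.mul_apply, Matrix.star_apply, sum_apply, inner_sum, PiLp.inner_apply, P,
      mul_apply_eq_comp, ContinuousLinearMap.star_eq_adjoint,
      ContinuousLinearMap.adjoint_inner_right]
  have hP1 : ‖P 1 u‖ = √(inner ℂ u (ψ 1 u)).re := by
    rw [@norm_eq_sqrt_re_inner ℂ, ← hP]
    simp
  have hP0 : ‖P 0 w‖ ≤ ‖x‖ * √(inner ℂ w (ψ 1 w)).re := by
    let _ := CStarAlgebra.spectralOrder F
    have _ := CStarAlgebra.spectralOrderedRing F
    have h1 := hψ.isPosElem_map (isPosElem_iff_nonneg.2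
      (sub_nonneg.2 (CStarAlgebra.mul_star_le_algebraMap_norm_sq (a := x))))
    have h2 := h1.re_inner_nonneg w
    rw [← Real.sqrt_sq (norm_nonneg x), ← Real.sqrt_mul (sq_nonneg _),
      @norm_eq_sqrt_re_inner ℂ, ← hP]
    refine Real.sqrt_le_sqrt ?_
    rw [Algebra.algebraMap_eq_smul_one, map_sub, ← Complex.coe_smul, map_smul, sub_apply,
      smul_apply, inner_sub_right, inner_smul_right, Complex.sub_re, Complex.re_ofReal_mul,
      sub_nonneg] at h2
    simpa using h2
  have h01 := hP 0 1 w u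
  simp only [Matrix.cons_val_zero, Matrix.cons_val_one, star_star, mul_one] at h01
  rw [h01, ← hP1]
  exact (norm_inner_le_norm _ _).trans (mul_le_mul_of_nonneg_right hP0 (norm_nonneg _))

lemma IsPosElem.norm_le_and_re_inner_le {b : H →L[ℂ] H} (hb : IsPosElem b) (z : H) :
    ‖z‖ ≤ ‖z + b z‖ ∧ (inner ℂ z (b z)).re ≤ ‖z + b z‖ ^ 2 / 4 := by
  have h0 := hb.re_inner_nonneg z
  have h1 := norm_add_sq (𝕜 := ℂ) z (b z)
  have h2 := norm_sub_sq (𝕜 := ℂ) z (b z)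
  simp only [RCLike.re_to_complex] at h1 h2
  refine ⟨abs_le_of_sq_le_sq' ?_ (norm_nonneg _) |>.2, ?_⟩
  · nlinarith [sq_nonneg ‖b z‖]
  · nlinarith [sq_nonneg ‖z - b z‖]

lemma IsPosElem.exists_inverse_one_add {B : Type*} [CStarAlgebra B] {S : StarSubalgebra ℂ B}
    (hS : IsClosed (S : Set B)) {b : B} (hbS : b ∈ S) (hb : IsPosElem b) :
    ∃ r ∈ S, IsSelfAdjoint r ∧ (1 + b) * r = 1 ∧ r * (1 + b) = 1 := by
  have hsa := hb.isSelfAdjoint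
  have hu : IsUnit (1 + b) := by
    obtain ⟨e, rfl⟩ := hb
    have h : (-1 : ℝ) ∉ spectrum ℝ (star e * e) := fun h => by
      linarith [spectrum_star_mul_self_nonneg _ h]
    rw [spectrum.notMem_iff] at h
    convert h.neg using 1
    simp only [map_neg, map_one]
    abel
  have : IsClosed (S : Set B) := hS
  obtain ⟨⟨s, r, hsr, hrs⟩, hs⟩ :=
    (StarSubalgebra.coe_isUnit S (a := ⟨1 + b, add_mem (one_mem S) hbS⟩)).1 hu
  have hs' : (s : B) = 1 + b := congrArg Subtype.val hs
  have h1 : (1 + b) * r = 1 := by rw [← hs']; exact congrArg Subtype.val hsr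
  have h2 : (r : B) * (1 + b) = 1 := by rw [← hs']; exact congrArg Subtype.val hrs
  refine ⟨r, r.2, ?_, h1, h2⟩
  have h3 := congrArg star h2
  rw [star_mul, star_one, star_add, star_one, hsa.star_eq] at h3
  exact (left_inv_eq_right_inv h2 h3).symm

lemma IsPosElem.exists_normalization {S : StarSubalgebra ℂ (H →L[ℂ] H)}
    (hS : IsClosed (S : Set (H →L[ℂ] H))) {b : H →L[ℂ] H} (hbS : b ∈ S) (hb : IsPosElem b) :
    ∃ c ∈ S, ∃ g ∈ S, IsSelfAdjoint c ∧ IsSelfAdjoint g ∧ c * b * c + g * g = 1 ∧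
      (∀ u, (inner ℂ (c u) (b (c u))).re ≤ ‖u‖ ^ 2) ∧ (∀ u, ‖g u‖ ≤ ‖u - b u‖) ∧
      ∀ u, (inner ℂ (u - c u) (b (u - c u))).re ≤ ‖u - b u‖ ^ 2 / 4 := by
  obtain ⟨r, hrS, hr, hbr, hrb⟩ := hb.exists_inverse_one_add hS hbS
  have hsa := hb.isSelfAdjoint
  have hcomm : b * r = r * b := by
    rw [add_mul, one_mul] at hbr
    rw [mul_add, mul_one, ← hbr] at hrb
    exact (add_left_cancel hrb).symm
  have hrb' : r * b = 1 - r := by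
    rw [mul_add, mul_one] at hrb
    exact eq_sub_of_add_eq' hrb
  have hres : ∀ u, ‖r u‖ ≤ ‖u‖ ∧ (inner ℂ (r u) (b (r u))).re ≤ ‖u‖ ^ 2 / 4 := by
    intro u
    have h := hb.norm_le_and_re_inner_le (r u)
    have h' : r u + b (r u) = u := DFunLike.congr_fun hbr u
    rwa [h'] at h
  have hg : (1 - b) * r = r * (1 - b) := by rw [sub_mul, mul_sub, hcomm, one_mul, mul_one]
  have hc : 1 - (2 : ℂ) • r = -(r * (1 - b)) := by
    rw [mul_sub, hrb', mul_one, two_smul]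
    abel
  have hcu : ∀ u, u - ((2 : ℂ) • r) u = - r (u - b u) := fun u => DFunLike.congr_fun hc u
  refine ⟨(2 : ℂ) • r, S.smul_mem hrS _, (1 - b) * r,
    mul_mem (sub_mem (one_mem S) hbS) hrS, ?_, ?_, ?_, ?_, ?_, ?_⟩
  · rw [IsSelfAdjoint, star_smul, hr.star_eq]
    simp
  · rw [IsSelfAdjoint, star_mul, hr.star_eq, star_sub, star_one, hsa.star_eq, hg]
  · have h1 : r * b * r = r - r * r := by rw [hrb', sub_mul, one_mul]
    have h2 : (1 - b) * r = 2 * r - 1 := by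
      rw [hg, mul_sub, hrb', mul_one, two_mul]
      abel
    rw [h2, two_smul]
    simp only [add_mul, mul_add, sub_mul, mul_sub, h1, two_mul, one_mul, mul_one]
    abel
  · intro u
    have := (hres ((2 : ℂ) • u)).2
    rw [norm_smul, map_smul] at this
    rw [smul_apply]
    refine this.trans (le_of_eq ?_)
    rw [Complex.norm_two]
    ring
  · intro u
    rw [hg]
    exact (hres (u - b u)).1
  · intro u
    rw [hcu, map_neg, inner_neg_neg]
    exact (hres _).2

end Normalization

section Main

variable {F : Type*} [CStarAlgebra F] {H : Type*} [NormedAddCommGroup H] [InnerProductSpace ℂ H]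
  [CompleteSpace H]

lemma CompletelyPositive.norm_inner_sub_conj_le {ψ : F →ₗ[ℂ] (H →L[ℂ] H)}
    (hψ : CompletelyPositive ψ) {c : H →L[ℂ] H}
    (hc : IsSelfAdjoint c) (hcb : ∀ u, (inner ℂ (c u) (ψ 1 (c u))).re ≤ ‖u‖ ^ 2)
    (hcs : ∀ u, (inner ℂ (u - c u) (ψ 1 (u - c u))).re ≤ ‖u - ψ 1 u‖ ^ 2 / 4)
    (x : F) (v w : H) :
    ‖inner ℂ w ((ψ x - c * ψ x * c) v)‖ ≤ ‖x‖ * ‖w‖ * (‖v - ψ 1 v‖ / 2) +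
      ‖x‖ * (‖w - ψ 1 w‖ / 2) * (‖v‖ + ‖v - ψ 1 v‖) := by
  have hsplit : inner ℂ w ((ψ x - c * ψ x * c) v) =
      inner ℂ (c w) (ψ x (v - c v)) + inner ℂ (w - c w) (ψ x v) := by
    have hcw : inner ℂ (c w) (ψ x (c v)) = inner ℂ w (c (ψ x (c v))) :=
      hc.isSymmetric _ _
    simp only [sub_apply, mul_apply_eq_comp, map_sub, inner_sub_right, inner_sub_left, hcw]
    ring
  have h1 : ∀ u, √(inner ℂ (c u) (ψ 1 (c u))).re ≤ ‖u‖ := fun u =>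
    Real.sqrt_le_iff.2 ⟨norm_nonneg u, hcb u⟩
  have h2 : ∀ u, √(inner ℂ (u - c u) (ψ 1 (u - c u))).re ≤ ‖u - ψ 1 u‖ / 2 := fun u =>
    Real.sqrt_le_iff.2 ⟨by positivity, (hcs u).trans (by rw [div_pow]; norm_num)⟩
  have h3 : √(inner ℂ v (ψ 1 v)).re ≤ ‖v‖ + ‖v - ψ 1 v‖ := by
    refine Real.sqrt_le_iff.2 ⟨by positivity, ?_⟩
    have h4 : (inner ℂ v (ψ 1 v)).re ≤ ‖v‖ * ‖ψ 1 v‖ :=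
      (Complex.re_le_norm _).trans (norm_inner_le_norm _ _)
    have h5 : ‖ψ 1 v‖ ≤ ‖v‖ + ‖v - ψ 1 v‖ := by
      simpa using norm_sub_le v (v - ψ 1 v)
    nlinarith [norm_nonneg v, norm_nonneg (v - ψ 1 v)]
  rw [hsplit]
  refine (norm_add_le _ _).trans (add_le_add ?_ ?_)
  · refine (hψ.norm_inner_le x _ _).trans ?_
    gcongr
    exacts [h1 w, h2 v]
  · refine (hψ.norm_inner_le x _ _).trans ?_
    gcongr
    exact h2 w

lemma CompletelyPositive.exists_unital_near [FiniteDimensional ℂ F] [Nontrivial F]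
    {S : StarSubalgebra ℂ (H →L[ℂ] H)} (hS : IsClosed (S : Set (H →L[ℂ] H)))
    {φ : F →ₗ[ℂ] (H →L[ℂ] H)} (hφ1 : φ 1 = 1) (hφ : CompletelyPositive φ)
    (hφS : ∀ x, φ x ∈ (S : Set (H →L[ℂ] H)).centralizer.centralizer)
    {δ : ℝ} (hδ : 0 < δ) (data : Finset (F × H × H)) :
    ∃ ψ : F →ₗ[ℂ] (H →L[ℂ] H), (∀ x, ψ x ∈ S) ∧ ψ 1 = 1 ∧ CompletelyPositive ψ ∧
      ∀ p ∈ data, ‖inner ℂ p.2.2 ((φ p.1 - ψ p.1) p.2.1)‖ ≤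
        ‖p.2.2‖ * δ + ‖p.1‖ * ‖p.2.2‖ * (δ / 2) + ‖p.1‖ * (δ / 2) * (‖p.2.1‖ + δ) +
          ‖regularTrace F p.1 / regularTrace F 1‖ * (δ * δ) := by
  obtain ⟨n, y, hy, hy1⟩ := exists_trace_orthonormal_basis F
  obtain ⟨D, hD, hφD⟩ := hφ.exists_eq_kernelMap hy hy1 hφS
  obtain ⟨κ, _, D', hD', hnear⟩ := exists_kernelMap_near (τ := regularTrace F) (y := y)
    (ι := data × Fin 3) S hD (fun a => ![a.1.1.1, 1, 1] a.2)
    (fun a => ![a.1.1.2.1, a.1.1.2.1, a.1.1.2.2] a.2) hδ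
  rw [← hφD] at hnear
  set ψ := kernelMap (regularTrace F) y D'
  have hψ : CompletelyPositive ψ := completelyPositive_kernelMap hy regularTrace_star D'
  have hψ1 : IsPosElem (ψ 1) := hψ.isPosElem_map ⟨1, by simp⟩
  obtain ⟨c, hcS, g, hgS, hc, hg, hcg, hcb, hgb, hcs⟩ :=
    hψ1.exists_normalization hS (kernelMap_mem hD' 1)
  let ψ' := kernelMap (regularTrace F) y (Sum.elim (fun l i => D' l i * c) fun l i =>
    ((√(Module.finrank ℂ F : ℝ)⁻¹ : ℝ) : ℂ) • if l = i then g else 0)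
  have hψ' : ∀ x, ψ' x = c * ψ x * c + (regularTrace F x / regularTrace F 1) • (g * g) := by
    intro x
    simp only [ψ']
    rw [kernelMap_sumElim, kernelMap_sqrt_smul _ (by positivity), LinearMap.add_apply,
      LinearMap.smul_apply, kernelMap_mul_right, hc.star_eq,
      kernelMap_diagonal hy1 regularTrace_mul_comm, hg.star_eq, smul_smul, regularTrace_one,
      div_eq_inv_mul]
    push_cast
    rfl
  refine ⟨ψ', kernelMap_mem ?_, ?_, completelyPositive_kernelMap hy regularTrace_star _, ?_⟩
  · rintro (l | l) i
    · exact mul_mem (hD' l i) hcS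
    · refine S.smul_mem ?_ _
      split_ifs
      exacts [hgS, zero_mem S]
  · have h1 : regularTrace F 1 ≠ 0 := by
      rw [regularTrace_one]
      exact Nat.cast_ne_zero.2 Module.finrank_pos.ne'
    rw [hψ', div_self h1, one_smul, hcg]
  · rintro ⟨x, v, w⟩ hp
    have hxv : ‖φ x v - ψ x v‖ ≤ δ := (hnear (⟨_, hp⟩, 0)).le
    have hv : ‖v - ψ 1 v‖ ≤ δ := by
      have : ‖φ 1 v - ψ 1 v‖ < δ := hnear (⟨_, hp⟩, 1)
      rw [hφ1] at this
      exact this.le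
    have hw : ‖w - ψ 1 w‖ ≤ δ := by
      have : ‖φ 1 w - ψ 1 w‖ < δ := hnear (⟨_, hp⟩, 2)
      rw [hφ1] at this
      exact this.le
    have hsplit : inner ℂ w ((φ x - ψ' x) v) = inner ℂ w (φ x v - ψ x v) +
        inner ℂ w ((ψ x - c * ψ x * c) v) -
        regularTrace F x / regularTrace F 1 * inner ℂ (g w) (g v) := by
      have hgw : inner ℂ (g w) (g v) = inner ℂ w (g (g v)) := hg.isSymmetric _ _
      rw [hgw, hψ', ← inner_smul_right, ← inner_add_right, ← inner_sub_right]
      congr 1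
      simp only [sub_apply, add_apply, smul_apply, mul_apply_eq_comp]
      abel
    dsimp only
    rw [hsplit]
    refine (norm_sub_le _ _).trans (add_le_add ((norm_add_le _ _).trans ?_) ?_)
    · rw [add_assoc]
      refine add_le_add ?_ ?_
      · refine (norm_inner_le_norm _ _).trans ?_
        gcongr
      · refine (hψ.norm_inner_sub_conj_le hc hcb hcs x v w).trans ?_
        gcongr
    · rw [norm_mul]
      gcongr
      refine (norm_inner_le_norm _ _).trans ?_
      gcongr
      exacts [(hgb w).trans hw, (hgb v).trans hv]

end Main

/-- Let `F` be a finite-dimensional C*-algebra and `A` a unital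
C*-algebra, realised as a norm-closed unital `*`-subalgebra `S ⊆ B(H)`; its weak closure,
the double commutant `S''`, plays the role of the enveloping von Neumann algebra `A**`
(which it is, for the universal representation).  Then every u.c.p. map `φ : F → S''` can
be approximated in the point-ultraweak (point-weak-operator) topology by u.c.p. maps
`F → S`: for every `ε > 0` and finite set of data `(x, v, w) ∈ F × H × H` there is a
u.c.p. map `ψ : F → S` with `|⟨(φ(x) - ψ(x)) v, w⟩| < ε` for all data in the set. -/
theorem stmt11 (F : Type) [CStarAlgebra F] [FiniteDimensional ℂ F]
    (H : Type) [NormedAddCommGroup H] [InnerProductSpace ℂ H] [CompleteSpace H]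
    (S : StarSubalgebra ℂ (H →L[ℂ] H)) (hS : IsClosed (S : Set (H →L[ℂ] H)))
    (φ : F →ₗ[ℂ] (H →L[ℂ] H)) (hφ1 : φ 1 = 1) (hφcp : CompletelyPositive φ)
    (hφrange : ∀ x, φ x ∈ Set.centralizer (Set.centralizer (S : Set (H →L[ℂ] H))))
    (ε : ℝ) (hε : 0 < ε) (data : Finset (F × H × H)) :
    ∃ ψ : F →ₗ[ℂ] (H →L[ℂ] H), (∀ x, ψ x ∈ S) ∧ ψ 1 = 1 ∧ CompletelyPositive ψ ∧
      ∀ p ∈ data, ‖@inner ℂ H _ ((φ p.1 - ψ p.1) p.2.1) p.2.2‖ < ε := by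
  rcases subsingleton_or_nontrivial F with hF | hF
  · refine ⟨φ, fun x => ?_, hφ1, hφcp, fun p _ => by simpa using hε⟩
    rw [Subsingleton.elim x 0, map_zero]
    exact zero_mem S
  · let bound : F × H × H → ℝ → ℝ := fun p δ => ‖p.2.2‖ * δ + ‖p.1‖ * ‖p.2.2‖ * (δ / 2) +
      ‖p.1‖ * (δ / 2) * (‖p.2.1‖ + δ) + ‖regularTrace F p.1 / regularTrace F 1‖ * (δ * δ)
    have hbound : ∀ p ∈ data, ∀ᶠ δ in nhdsWithin 0 (Set.Ioi 0), bound p δ < ε := by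
      intro p _
      have hcont : Continuous (bound p) := by fun_prop
      refine nhdsWithin_le_nhds (hcont.continuousAt.eventually_lt_const ?_)
      simpa [bound] using hε
    obtain ⟨δ, hδ, hδ0⟩ := (((Filter.eventually_all_finset data).2 hbound).and
      self_mem_nhdsWithin).exists
    obtain ⟨ψ, hψS, hψ1, hψ, hnear⟩ := hφcp.exists_unital_near hS hφ1 hφrange hδ0 data
    refine ⟨ψ, hψS, hψ1, hψ, fun p hp => ?_⟩
    rw [norm_inner_symm]
    exact (hnear p hp).trans_lt (hδ p hp)

end
end
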